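/- Let d ≥ 1 and let Ω = {(t,x) ∈ ℝ × ℝ^d : |x| > 1 + |t|}. Let u : ℝ × ℝ^d → ℝ be twice continuously differentiable on ℝ^{1+d}, suppose u vanishes on the topological boundary ∂Ω, and suppose there is a constant C ≥ 0 such that for every point (t,x) ∈ Ω one has |∂_t²u(t,x) − Δ_x u(t,x)| ≤ C(|u(t,x)| + |∂_t u(t,x)| + |∇_x u(t,x)|). Then u vanishes identically on Ω. -/

import Mathlib

open MeasureTheory

namespace UCW

/-! ### Part 1: pure algebra -/

theorem alg_id {ι : Type*} [Fintype ι] (σ p X Ψd : ι → ℝ) (h Xd : ι → ι → ℝ)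
    (hs : ∀ a b, h a b = h b a) (v Ψ : ℝ) :
    ∑ a, σ a * (2 * h a a * (∑ b, σ b * X b * p b)
      + 2 * p a * (∑ b, σ b * (Xd b a * p b + X b * h b a))
      - Xd a a * (∑ b, σ b * p b ^ 2) - X a * (∑ b, σ b * (2 * p b * h b a))
      + Ψd a * v * p a + Ψ * p a * p a + Ψ * v * h a a
      + (∑ b, σ b * (2 * X b * Xd b a)) * X a * v ^ 2
      + (∑ b, σ b * X b ^ 2) * Xd a a * v ^ 2
      + (∑ b, σ b * X b ^ 2) * X a * (2 * v * p a))
    = ((∑ a, σ a * h a a) + (∑ b, σ b * X b ^ 2) * v) * (2 * (∑ b, σ b * X b * p b) + Ψ * v)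
      + 2 * (∑ a, ∑ b, σ a * σ b * Xd b a * p a * p b)
      + (Ψ - ∑ a, σ a * Xd a a) * (∑ b, σ b * p b ^ 2)
      + v * (∑ a, σ a * Ψd a * p a)
      + (2 * (∑ a, ∑ b, σ a * σ b * Xd b a * X a * X b)
          - (∑ b, σ b * X b ^ 2) * (Ψ - ∑ a, σ a * Xd a a)) * v ^ 2 := by
  have e1 : ∑ a, ∑ b, σ a * σ b * p a * X b * h b a = ∑ a, ∑ b, σ a * σ b * X a * p b * h b a := by
    rw [Finset.sum_comm]
    refine Finset.sum_congr rfl fun a _ => Finset.sum_congr rfl fun b _ => ?_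
    rw [hs a b]; ring
  generalize hP : ∑ b, σ b * X b * p b = P
  generalize hQ : ∑ b, σ b * p b ^ 2 = Q
  generalize hR : ∑ b, σ b * X b ^ 2 = R
  have e2 : ∀ a, σ a * (2 * h a a * P
      + 2 * p a * (∑ b, σ b * (Xd b a * p b + X b * h b a))
      - Xd a a * Q - X a * (∑ b, σ b * (2 * p b * h b a))
      + Ψd a * v * p a + Ψ * p a * p a + Ψ * v * h a a
      + (∑ b, σ b * (2 * X b * Xd b a)) * X a * v ^ 2
      + R * Xd a a * v ^ 2
      + R * X a * (2 * v * p a))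
      = (2 * P + Ψ * v) * (σ a * h a a) + 2 * (∑ b, σ a * σ b * Xd b a * p a * p b)
        + 2 * (∑ b, σ a * σ b * p a * X b * h b a) - 2 * (∑ b, σ a * σ b * X a * p b * h b a)
        - Q * (σ a * Xd a a) + v * (σ a * Ψd a * p a) + Ψ * (σ a * p a ^ 2)
        + 2 * v ^ 2 * (∑ b, σ a * σ b * Xd b a * X a * X b)
        + R * v ^ 2 * (σ a * Xd a a) + 2 * R * v * (σ a * X a * p a) := by
    intro a
    have t1 : ∑ b, σ b * (Xd b a * p b + X b * h b a)
        = ∑ b, σ b * Xd b a * p b + ∑ b, σ b * X b * h b a := by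
      rw [← Finset.sum_add_distrib]; exact Finset.sum_congr rfl fun b _ => by ring
    have t2 : ∑ b, σ b * (2 * p b * h b a) = 2 * ∑ b, σ b * p b * h b a := by
      rw [Finset.mul_sum]; exact Finset.sum_congr rfl fun b _ => by ring
    have t3 : ∑ b, σ b * (2 * X b * Xd b a) = 2 * ∑ b, σ b * X b * Xd b a := by
      rw [Finset.mul_sum]; exact Finset.sum_congr rfl fun b _ => by ring
    have t4 : ∑ b, σ a * σ b * Xd b a * p a * p b = σ a * p a * ∑ b, σ b * Xd b a * p b := by
      rw [Finset.mul_sum]; exact Finset.sum_congr rfl fun b _ => by ring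
    have t5 : ∑ b, σ a * σ b * p a * X b * h b a = σ a * p a * ∑ b, σ b * X b * h b a := by
      rw [Finset.mul_sum]; exact Finset.sum_congr rfl fun b _ => by ring
    have t6 : ∑ b, σ a * σ b * X a * p b * h b a = σ a * X a * ∑ b, σ b * p b * h b a := by
      rw [Finset.mul_sum]; exact Finset.sum_congr rfl fun b _ => by ring
    have t7 : ∑ b, σ a * σ b * Xd b a * X a * X b = σ a * X a * ∑ b, σ b * X b * Xd b a := by
      rw [Finset.mul_sum]; exact Finset.sum_congr rfl fun b _ => by ring
    rw [t1, t2, t3, t4, t5, t6, t7]; ring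
  rw [Finset.sum_congr rfl fun a _ => e2 a]
  simp only [Finset.sum_add_distrib, Finset.sum_sub_distrib, ← Finset.mul_sum]
  rw [e1, hP, hQ]
  ring

/-- The contraction of the explicit Hessian `l G (2 s δ - 4 f f)`. -/
theorem hess_contract {ι : Type*} [Fintype ι] [DecidableEq ι] (σ s f p : ι → ℝ)
    (hσ : ∀ a, σ a ^ 2 = 1) (c : ℝ) :
    ∑ a, ∑ b, σ a * σ b * (c * ((if b = a then 2 * s a else 0) - 4 * f a * f b)) * p a * p b
      = c * (2 * (∑ a, s a * p a ^ 2) - 4 * (∑ a, σ a * f a * p a) ^ 2) := by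
  have e2 : ∀ a, ∑ b, σ a * σ b * (c * ((if b = a then 2 * s a else 0) - 4 * f a * f b)) * p a * p b
      = c * 2 * (s a * p a ^ 2) - (c * 4 * (∑ b, σ b * f b * p b)) * (σ a * f a * p a) := by
    intro a
    have : ∀ b, σ a * σ b * (c * ((if b = a then 2 * s a else 0) - 4 * f a * f b)) * p a * p b
       = (if b = a then σ a * σ b * c * 2 * s a * p a * p b else 0)
         - c * 4 * (σ a * f a * p a) * (σ b * f b * p b) := by
      intro b; split_ifs <;> ring
    rw [Finset.sum_congr rfl fun b _ => this b, Finset.sum_sub_distrib, Finset.sum_ite_eq',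
      ← Finset.mul_sum]
    simp only [Finset.mem_univ, if_true]
    have := hσ a
    linear_combination (c * 2 * s a * p a ^ 2) * this
  rw [Finset.sum_congr rfl fun a _ => e2 a, Finset.sum_sub_distrib, ← Finset.mul_sum,
    ← Finset.mul_sum]
  ring

/-- Final real-variable absorption. -/
theorem absorb (l ε g G B C n v S2 N W DJ SA Zp Zx cross N2 : ℝ) (hl1 : 1 ≤ l) (hε : 0 < ε) (hg : 0 < g)
    (hG : g ≤ G) (hS2 : 0 ≤ S2)
    (hl2 : 6 * C ^ 2 ≤ l * (ε * g))
    (hl3 : 1 + 3 * C ^ 2 + 6 * C ^ 2 * n * B ^ 2 + B ^ 2 + n * B ^ 2 / (4 * ε * g) ≤ 8 * l * g ^ 3)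
    (hn : 0 ≤ n)
    (hDJ : DJ = SA + Zp + cross + Zx * v ^ 2)
    (hSA : SA ≤ N ^ 2 + W ^ 2 * v ^ 2) (hW : W ^ 2 ≤ l ^ 2 * B ^ 2)
    (hN2 : N ^ 2 = N2)
    (hN : N2 ≤ 3 * C ^ 2 * (v ^ 2 + 2 * S2 + 2 * n * l ^ 2 * B ^ 2 * v ^ 2))
    (hZp : Zp ≤ - (2 * ε * l * G * S2))
    (hZx : Zx ≤ - (8 * l ^ 3 * G ^ 3))
    (hcross : cross ≤ l * (ε * g * S2 + n * (B ^ 2 / (4 * ε * g)) * v ^ 2)) :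
    DJ + v ^ 2 ≤ 0 := by
  have hv := sq_nonneg v
  have h1 : Zp ≤ - (2 * ε * l * g * S2) := by
    refine hZp.trans ?_
    have : 2 * ε * l * g * S2 ≤ 2 * ε * l * G * S2 := by gcongr
    linarith
  have h2 : Zx * v ^ 2 ≤ - (8 * l ^ 3 * g ^ 3) * v ^ 2 := by
    refine mul_le_mul_of_nonneg_right (hZx.trans ?_) hv
    have : 8 * l ^ 3 * g ^ 3 ≤ 8 * l ^ 3 * G ^ 3 := by gcongr
    linarith
  have h3 : W ^ 2 * v ^ 2 ≤ l ^ 2 * B ^ 2 * v ^ 2 := mul_le_mul_of_nonneg_right hW hv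
  have h4 : 6 * C ^ 2 * S2 ≤ l * (ε * g) * S2 := mul_le_mul_of_nonneg_right hl2 hS2
  have hK : 0 ≤ n * B ^ 2 / (4 * ε * g) := by positivity
  have hll : (1:ℝ) ≤ l ^ 2 := by nlinarith
  have hl12 : l ≤ l ^ 2 := by nlinarith
  have h5 : 1 + 3 * C ^ 2 + (6 * C ^ 2 * n * B ^ 2 + B ^ 2) * l ^ 2 + l * (n * B ^ 2 / (4 * ε * g))
      ≤ 8 * l ^ 3 * g ^ 3 := by
    have a1 := mul_le_mul_of_nonneg_left hl3 (sq_nonneg l)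
    have a2 : 1 + 3 * C ^ 2 ≤ l ^ 2 * (1 + 3 * C ^ 2) := by
      nlinarith [sq_nonneg C]
    have a3 := mul_le_mul_of_nonneg_right hl12 hK
    nlinarith
  have h6 := mul_le_mul_of_nonneg_right h5 hv
  have h7 : n * (B ^ 2 / (4 * ε * g)) = n * B ^ 2 / (4 * ε * g) := by ring
  rw [h7] at hcross
  rw [hDJ]
  nlinarith

theorem cross_bound {ι : Type*} [Fintype ι] (σ p Ψd : ι → ℝ) (hσ : ∀ a, σ a ^ 2 = 1) (v l B θ : ℝ)
    (hl : 0 ≤ l) (hθ : 0 < θ) (hB : ∀ a, |Ψd a| ≤ l * B) :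
    v * (∑ a, σ a * Ψd a * p a)
      ≤ l * (θ * (∑ a, p a ^ 2) + (Fintype.card ι : ℝ) * (B ^ 2 / (4 * θ)) * v ^ 2) := by
  have : ∀ a, v * (σ a * Ψd a * p a) ≤ l * (θ * p a ^ 2 + (B ^ 2 / (4 * θ)) * v ^ 2) := by
    intro a
    have h1 : |σ a| = 1 := by
      have := hσ a; rw [← sq_abs] at this
      nlinarith [abs_nonneg (σ a)]
    have hB0 : 0 ≤ l * B := (abs_nonneg _).trans (hB a)
    calc v * (σ a * Ψd a * p a) ≤ |v * (σ a * Ψd a * p a)| := le_abs_self _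
      _ = |Ψd a| * (|v| * |p a|) := by rw [abs_mul, abs_mul, abs_mul, h1]; ring
      _ ≤ l * B * (|v| * |p a|) := by gcongr; exact hB a
      _ = l * (B * |v| * |p a|) := by ring
      _ ≤ l * (θ * p a ^ 2 + (B ^ 2 / (4 * θ)) * v ^ 2) := by
        gcongr
        rw [← sq_abs v, ← sq_abs (p a)]
        have : θ * |p a| ^ 2 + B ^ 2 / (4 * θ) * |v| ^ 2 - B * |v| * |p a|
          = (2 * θ * |p a| - B * |v|) ^ 2 / (4 * θ) := by field_simp; ring
        have h2 : 0 ≤ (2 * θ * |p a| - B * |v|) ^ 2 / (4 * θ) := by positivity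
        linarith
  rw [Finset.mul_sum]
  refine (Finset.sum_le_sum fun a _ => this a).trans (le_of_eq ?_)
  rw [← Finset.mul_sum, Finset.sum_add_distrib, ← Finset.mul_sum, Finset.sum_const,
    Finset.card_univ, nsmul_eq_mul]
  ring


/-! ### Part 2: coordinates, weights, current -/

abbrev E (d : ℕ) := ℝ × EuclideanSpace ℝ (Fin d)

noncomputable def e {d : ℕ} : Option (Fin d) → E d
  | none => ((1 : ℝ), 0)
  | some j => ((0 : ℝ), EuclideanSpace.single j (1 : ℝ))

noncomputable def y {d : ℕ} : Option (Fin d) → E d → ℝ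
  | none => fun p => p.1
  | some j => fun p => p.2 j

def sg {d : ℕ} : Option (Fin d) → ℝ
  | none => -1
  | some _ => 1

def ss {d : ℕ} (k : ℝ) : Option (Fin d) → ℝ
  | none => -k
  | some _ => 1

theorem sg_sq {d : ℕ} (a : Option (Fin d)) : sg a ^ 2 = 1 := by
  cases a <;> simp [sg]

theorem y_smooth {d : ℕ} (a : Option (Fin d)) : ContDiff ℝ 2 (y a : E d → ℝ) := by
  cases a with
  | none => exact contDiff_fst
  | some j =>
    change ContDiff ℝ 2 (fun p : E d => p.2 j)
    fun_prop

theorem y_line {d : ℕ} (a b : Option (Fin d)) (p : E d) (τ : ℝ) :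
    y a (p + τ • e b) = y a p + τ * (if a = b then 1 else 0) := by
  cases a <;> cases b <;> simp [y, e]

noncomputable def D {d : ℕ} (a : Option (Fin d)) (g : E d → ℝ) (p : E d) : ℝ := fderiv ℝ g p (e a)

theorem line_deriv {d : ℕ} {g : E d → ℝ} {p : E d} (hg : DifferentiableAt ℝ g p)
    (a : Option (Fin d)) : HasDerivAt (fun τ : ℝ => g (p + τ • e a)) (D a g p) 0 := by
  have h := hg.hasFDerivAt.hasLineDerivAt (e a)
  exact h

theorem D_eq {d : ℕ} {g : E d → ℝ} {p : E d} (hg : DifferentiableAt ℝ g p)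
    (a : Option (Fin d)) {c : ℝ} (h : HasDerivAt (fun τ : ℝ => g (p + τ • e a)) c 0) :
    D a g p = c := (line_deriv hg a).unique h

noncomputable def ff {d : ℕ} (k : ℝ) (p : E d) : ℝ := ∑ a, ss k a * y a p ^ 2

noncomputable def GG {d : ℕ} (k : ℝ) (p : E d) : ℝ := 4 * Real.exp (-4 * ff k p)

/-- gradient of the weight `-exp (-4 f)` -/
noncomputable def xi {d : ℕ} (k : ℝ) (a : Option (Fin d)) (p : E d) : ℝ :=
  GG k p * (2 * ss k a * y a p)

noncomputable def xid {d : ℕ} (k : ℝ) (a b : Option (Fin d)) (p : E d) : ℝ :=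
  GG k p * ((if a = b then 2 * ss k b else 0) - 4 * (2 * ss k b * y b p) * (2 * ss k a * y a p))

noncomputable def psi {d : ℕ} (k m : ℝ) (p : E d) : ℝ :=
  (∑ a, sg a * xid k a a p) - 4 * m * GG k p

theorem ff_smooth {d : ℕ} (k : ℝ) : ContDiff ℝ 2 (ff k : E d → ℝ) := by
  unfold ff
  exact ContDiff.sum fun a _ => contDiff_const.mul ((y_smooth a).pow 2)

theorem GG_smooth {d : ℕ} (k : ℝ) : ContDiff ℝ 2 (GG k : E d → ℝ) := by
  unfold GG
  exact contDiff_const.mul (Real.contDiff_exp.comp (contDiff_const.mul (ff_smooth k)))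

theorem xi_smooth {d : ℕ} (k : ℝ) (a : Option (Fin d)) : ContDiff ℝ 2 (xi k a : E d → ℝ) := by
  unfold xi
  exact (GG_smooth k).mul (contDiff_const.mul (y_smooth a))

theorem xid_smooth {d : ℕ} (k : ℝ) (a b : Option (Fin d)) :
    ContDiff ℝ 2 (xid k a b : E d → ℝ) := by
  unfold xid
  exact (GG_smooth k).mul (contDiff_const.sub ((contDiff_const.mul
    (contDiff_const.mul (y_smooth b))).mul (contDiff_const.mul (y_smooth a))))

theorem psi_smooth {d : ℕ} (k m : ℝ) : ContDiff ℝ 2 (psi k m : E d → ℝ) := by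
  unfold psi
  exact (ContDiff.sum fun a _ => contDiff_const.mul (xid_smooth k a a)).sub
    (contDiff_const.mul (GG_smooth k))

theorem GG_pos {d : ℕ} (k : ℝ) (p : E d) : 0 < GG k p := by unfold GG; positivity

theorem y_D {d : ℕ} (a b : Option (Fin d)) (p : E d) :
    HasDerivAt (fun τ : ℝ => y a (p + τ • e b)) (if a = b then 1 else 0) 0 := by
  simp only [y_line]
  simpa using ((hasDerivAt_id (0:ℝ)).mul_const (if a = b then (1:ℝ) else 0)).const_add (y a p)

theorem ff_D {d : ℕ} (k : ℝ) (b : Option (Fin d)) (p : E d) :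
    HasDerivAt (fun τ : ℝ => ff k (p + τ • e b)) (2 * ss k b * y b p) 0 := by
  unfold ff
  have h := HasDerivAt.fun_sum (u := Finset.univ) fun a _ => ((y_D a b p).pow 2).const_mul (ss k a)
  refine h.congr_deriv ?_
  simp
  ring

theorem GG_D {d : ℕ} (k : ℝ) (b : Option (Fin d)) (p : E d) :
    HasDerivAt (fun τ : ℝ => GG k (p + τ • e b)) (GG k p * (-4 * (2 * ss k b * y b p))) 0 := by
  unfold GG
  have h := (((ff_D k b p).const_mul (-4)).exp).const_mul 4
  refine h.congr_deriv ?_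
  simp
  ring

theorem xi_D {d : ℕ} (k : ℝ) (a b : Option (Fin d)) (p : E d) :
    HasDerivAt (fun τ : ℝ => xi k a (p + τ • e b)) (xid k a b p) 0 := by
  unfold xi xid
  have h := (GG_D k b p).mul ((y_D a b p).const_mul (2 * ss k a))
  refine h.congr_deriv ?_
  simp only [zero_smul, add_zero]
  split_ifs with hab
  · subst hab; ring
  · ring

/-- the conjugated function -/
noncomputable def vv {d : ℕ} (k l : ℝ) (u : E d → ℝ) (p : E d) : ℝ :=
  Real.exp (l * Real.exp (-4 * ff k p)) * u p

theorem vv_smooth {d : ℕ} (k l : ℝ) {u : E d → ℝ} (hu : ContDiff ℝ 2 u) :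
    ContDiff ℝ 2 (vv k l u) := by
  unfold vv
  exact (Real.contDiff_exp.comp (contDiff_const.mul
    (Real.contDiff_exp.comp (contDiff_const.mul (ff_smooth k))))).mul hu

theorem wt_D {d : ℕ} (k l : ℝ) (b : Option (Fin d)) (p : E d) :
    HasDerivAt (fun τ : ℝ => Real.exp (l * Real.exp (-4 * ff k (p + τ • e b))))
      (- (l * xi k b p) * Real.exp (l * Real.exp (-4 * ff k p))) 0 := by
  have h := ((((ff_D k b p).const_mul (-4)).exp).const_mul l).exp
  refine h.congr_deriv ?_
  simp [xi, GG]
  ring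

theorem D_smooth {d : ℕ} {g : E d → ℝ} (hg : ContDiff ℝ 2 g) (a : Option (Fin d)) :
    ContDiff ℝ 1 (D a g) := by
  unfold D
  exact (hg.fderiv_right (m := 1) (by norm_num)).clm_apply contDiff_const

theorem D_vv {d : ℕ} (k l : ℝ) {u : E d → ℝ} (hu : ContDiff ℝ 2 u) (a : Option (Fin d)) (p : E d) :
    D a (vv k l u) p = Real.exp (l * Real.exp (-4 * ff k p)) * (D a u p - l * xi k a p * u p) := by
  refine D_eq ((vv_smooth k l hu).differentiable (by norm_num) p) a ?_
  have h := (wt_D k l a p).mul (line_deriv (hu.differentiable (by norm_num) p) a)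
  refine h.congr_deriv ?_
  simp
  ring

theorem DD_vv {d : ℕ} (k l : ℝ) {u : E d → ℝ} (hu : ContDiff ℝ 2 u) (a b : Option (Fin d)) (p : E d) :
    D b (D a (vv k l u)) p = Real.exp (l * Real.exp (-4 * ff k p)) *
      (D b (D a u) p - l * xi k a p * D b u p - l * xid k a b p * u p
       - l * xi k b p * (D a u p - l * xi k a p * u p)) := by
  refine D_eq ((D_smooth (vv_smooth k l hu) a).differentiable (by norm_num) p) b ?_
  simp only [D_vv k l hu]
  have h := (wt_D k l b p).mul ((line_deriv ((D_smooth hu a).differentiable (by norm_num) p) b).sub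
    (((xi_D k a b p).const_mul l).mul (line_deriv (hu.differentiable (by norm_num) p) b)))
  refine h.congr_deriv ?_
  simp
  ring

theorem DD_symm {d : ℕ} {u : E d → ℝ} (hu : ContDiff ℝ 2 u) (a b : Option (Fin d)) (p : E d) :
    D b (D a u) p = D a (D b u) p := by
  have hd : DifferentiableAt ℝ (fderiv ℝ u) p :=
    (hu.fderiv_right (m := 1) (by norm_num)).differentiable (by norm_num) p
  have h1 : ∀ a b : Option (Fin d), D b (D a u) p = fderiv ℝ (fderiv ℝ u) p (e b) (e a) := by
    intro a b
    unfold D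
    rw [fderiv_clm_apply hd (by fun_prop)]
    simp
  rw [h1, h1]
  exact (hu.contDiffAt.isSymmSndFDerivAt (by simp)) _ _

/-- the current -/
noncomputable def JJ {d : ℕ} (k m l : ℝ) (v : E d → ℝ) (a : Option (Fin d)) (p : E d) : ℝ :=
  sg a * (2 * D a v p * (∑ b, sg b * (l * xi k b p) * D b v p)
    - (l * xi k a p) * (∑ b, sg b * D b v p ^ 2)
    + (l * psi k m p) * v p * D a v p
    + (∑ b, sg b * (l * xi k b p) ^ 2) * (l * xi k a p) * v p ^ 2)

theorem JJ_smooth {d : ℕ} (k m l : ℝ) {v : E d → ℝ} (hv : ContDiff ℝ 2 v) (a : Option (Fin d)) :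
    ContDiff ℝ 1 (JJ k m l v a) := by
  have h1 := fun b => D_smooth hv b
  have h2 := fun b : Option (Fin d) => (xi_smooth k b).of_le (show (1 : WithTop ℕ∞) ≤ 2 by norm_num)
  have h3 := (psi_smooth (d := d) k m).of_le (show (1 : WithTop ℕ∞) ≤ 2 by norm_num)
  have h4 := hv.of_le (show (1 : WithTop ℕ∞) ≤ 2 by norm_num)
  unfold JJ
  fun_prop

theorem JJ_D {d : ℕ} (k m l : ℝ) {v : E d → ℝ} (hv : ContDiff ℝ 2 v) (a : Option (Fin d)) (p : E d) :
    ∀ c : Option (Fin d), D c (JJ k m l v a) p =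
    sg a * (2 * D c (D a v) p * (∑ b, sg b * (l * xi k b p) * D b v p)
      + 2 * D a v p * (∑ b, sg b * ((l * xid k b c p) * D b v p + (l * xi k b p) * D c (D b v) p))
      - (l * xid k a c p) * (∑ b, sg b * D b v p ^ 2)
      - (l * xi k a p) * (∑ b, sg b * (2 * D b v p * D c (D b v) p))
      + (l * D c (psi k m) p) * v p * D a v p + (l * psi k m p) * D c v p * D a v p
      + (l * psi k m p) * v p * D c (D a v) p
      + (∑ b, sg b * (2 * (l * xi k b p) * (l * xid k b c p))) * (l * xi k a p) * v p ^ 2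
      + (∑ b, sg b * (l * xi k b p) ^ 2) * (l * xid k a c p) * v p ^ 2
      + (∑ b, sg b * (l * xi k b p) ^ 2) * (l * xi k a p) * (2 * v p * D c v p)) := by
  intro c
  refine D_eq ((JJ_smooth k m l hv a).differentiable (by norm_num) p) c ?_
  have hx := fun b => (xi_D k b c p).const_mul l
  have hp := fun b => line_deriv ((D_smooth hv b).differentiable (by norm_num) p) c
  have hV := line_deriv (hv.differentiable (by norm_num) p) c
  have hψ := (line_deriv ((psi_smooth (d := d) k m).differentiable (by norm_num) p) c).const_mul l
  have s1 := HasDerivAt.fun_sum (u := Finset.univ) fun b _ => ((hx b).const_mul (sg b)).mul (hp b)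
  have s2 := HasDerivAt.fun_sum (u := Finset.univ) fun b _ => ((hp b).pow 2).const_mul (sg b)
  have s3 := HasDerivAt.fun_sum (u := Finset.univ) fun b _ => ((hx b).pow 2).const_mul (sg b)
  have h := (((((hp a).const_mul 2).mul s1).sub ((hx a).mul s2)).add
    ((hψ.mul hV).mul (hp a))).add ((s3.mul (hx a)).mul (hV.pow 2))
  refine (h.const_mul (sg a)).congr_deriv ?_
  simp only [zero_smul, add_zero, Pi.mul_apply, Pi.pow_apply, Nat.cast_ofNat, Nat.add_one_sub_one, pow_one]
  have t1 : ∑ b, sg b * ((l * xid k b c p) * D b v p + (l * xi k b p) * D c (D b v) p)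
     = ∑ b, (sg b * (l * xid k b c p) * D b v p + sg b * (l * xi k b p) * D c (D b v) p) :=
    Finset.sum_congr rfl fun b _ => by ring
  rw [t1]
  ring


/-! ### Part 3: the pointwise Carleman inequality -/

theorem region_alg (t r ε k m : ℝ) (hε : 0 < ε) (hε2 : ε ≤ 1 / 2) (hk : k = 1 + ε)
    (hm : m = 1 + ε / 2) (hr : 1 + |t| ≤ r) (ht : 2 * ε * |t| ≤ 1) :
    16 * (r ^ 2 - k ^ 3 * t ^ 2) - 128 * (r ^ 2 - k ^ 2 * t ^ 2) ^ 2
      + 16 * m * (r ^ 2 - k ^ 2 * t ^ 2) ≤ - 8 := by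
  have ht0 := abs_nonneg t
  have h2 : t ^ 2 = |t| ^ 2 := (sq_abs t).symm
  set s := |t|
  have hks : k * s ≤ s + 1 / 2 := by rw [hk]; nlinarith
  have hks0 : 0 ≤ k * s := by rw [hk]; positivity
  have hq : 1 / 2 ≤ r ^ 2 - k ^ 2 * t ^ 2 := by
    rw [h2]
    have a1 : (k * s) ^ 2 ≤ (s + 1 / 2) ^ 2 := by gcongr
    have a2 : (1 + s) ^ 2 ≤ r ^ 2 := by gcongr
    nlinarith
  have hq3 : r ^ 2 - k ^ 3 * t ^ 2 ≤ r ^ 2 - k ^ 2 * t ^ 2 := by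
    have : k ^ 2 * t ^ 2 ≤ k ^ 3 * t ^ 2 := by
      have : k ^ 3 * t ^ 2 - k ^ 2 * t ^ 2 = ε * (k ^ 2 * t ^ 2) := by rw [hk]; ring
      have : 0 ≤ ε * (k ^ 2 * t ^ 2) := by positivity
      linarith
    linarith
  set q := r ^ 2 - k ^ 2 * t ^ 2
  have hm2 : m ≤ 5 / 4 := by linarith
  have : m * q ≤ 5 / 4 * q := by nlinarith
  nlinarith

theorem sum_sq {d : ℕ} (x : EuclideanSpace ℝ (Fin d)) : ∑ j, x j ^ 2 = ‖x‖ ^ 2 := by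
  rw [EuclideanSpace.norm_sq_eq]; simp

set_option maxHeartbeats 2000000 in
theorem pointwise {d : ℕ} {u : E d → ℝ} (hu : ContDiff ℝ 2 u) (C ε k m g B l : ℝ) (p : E d)
    (hε : 0 < ε) (hε2 : ε ≤ 1 / 2) (hk : k = 1 + ε) (hm : m = 1 + ε / 2)
    (hr : 1 + |p.1| ≤ ‖p.2‖) (ht : 2 * ε * |p.1| ≤ 1)
    (hineq : |∑ a, sg a * D a (D a u) p| ≤ C * (|u p| + |D none u p|
      + Real.sqrt (∑ j : Fin d, (D (some j) u p) ^ 2)))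
    (hg : 0 < g) (hG : g ≤ GG k p) (hB1 : ∀ a, |xi k a p| ≤ B) (hB2 : ∀ a, |D a (psi k m) p| ≤ B)
    (hB3 : |4 * m * GG k p| ≤ B) (hl1 : 1 ≤ l)
    (hl2 : 6 * C ^ 2 ≤ l * (ε * g))
    (hl3 : 1 + 3 * C ^ 2 + 6 * C ^ 2 * (Fintype.card (Option (Fin d)) : ℝ) * B ^ 2 + B ^ 2
      + (Fintype.card (Option (Fin d)) : ℝ) * B ^ 2 / (4 * ε * g) ≤ 8 * l * g ^ 3) :
    ∑ a, D a (JJ k m l (vv k l u) a) p + vv k l u p ^ 2 ≤ 0 := by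
  have hl0 : 0 ≤ l := by linarith
  set v := vv k l u with hvdef
  have hv : ContDiff ℝ 2 v := vv_smooth k l hu
  set w := Real.exp (l * Real.exp (-4 * ff k p)) with hw
  have hG0 := GG_pos k p
  -- the identity
  have hid := alg_id (fun a => sg a) (fun a => D a v p) (fun a => l * xi k a p)
    (fun a => l * D a (psi k m) p) (fun a b => D b (D a v) p) (fun a b => l * xid k a b p)
    (fun a b => DD_symm hv a b p) (v p) (l * psi k m p)
  have hJ : ∑ a, D a (JJ k m l v a) p = _ :=
    (Finset.sum_congr rfl fun a _ => JJ_D k m l hv a p a).trans hid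
  -- W
  have hWeq : l * psi k m p - ∑ a, sg a * (l * xid k a a p) = - (4 * m * GG k p) * l := by
    unfold psi
    have : ∑ a : Option (Fin d), sg a * (l * xid k a a p) = l * ∑ a, sg a * xid k a a p := by
      rw [Finset.mul_sum]; exact Finset.sum_congr rfl fun b _ => by ring
    rw [this]; ring
  -- contraction
  have hc : ∀ z : Option (Fin d) → ℝ,
      ∑ a, ∑ b, sg a * sg b * (l * xid k b a p) * z a * z b
        = l * GG k p * (2 * (∑ a, ss k a * z a ^ 2)
          - 4 * (∑ a, sg a * (2 * ss k a * y a p) * z a) ^ 2) := by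
    intro z
    rw [← hess_contract (fun a => sg a) (fun a => ss k a) (fun a => 2 * ss k a * y a p) z
      (fun a => sg_sq a) (l * GG k p)]
    refine Finset.sum_congr rfl fun a _ => Finset.sum_congr rfl fun b _ => ?_
    unfold xid
    ring
  rw [hWeq, hc, hc] at hJ
  set S2 := ∑ a, D a v p ^ 2 with hS2
  refine absorb l ε g (GG k p) B C (Fintype.card (Option (Fin d)) : ℝ) (v p) S2
    (w * ∑ a, sg a * D a (D a u) p) (- (4 * m * GG k p) * l) _
    (((∑ a, sg a * D a (D a v) p) + (∑ b, sg b * (l * xi k b p) ^ 2) * v p) *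
      (2 * (∑ b, sg b * (l * xi k b p) * D b v p) + l * psi k m p * v p))
    (2 * (l * GG k p * (2 * (∑ a, ss k a * D a v p ^ 2)
          - 4 * (∑ a, sg a * (2 * ss k a * y a p) * D a v p) ^ 2))
          + (- (4 * m * GG k p) * l) * (∑ b, sg b * D b v p ^ 2))
    (2 * (l * GG k p * (2 * (∑ a, ss k a * (l * xi k a p) ^ 2)
          - 4 * (∑ a, sg a * (2 * ss k a * y a p) * (l * xi k a p)) ^ 2))
          - (∑ b, sg b * (l * xi k b p) ^ 2) * (- (4 * m * GG k p) * l))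
    (v p * (∑ a, sg a * (l * D a (psi k m) p) * D a v p)) _ hl1 hε hg hG
    (Finset.sum_nonneg fun a _ => sq_nonneg _) hl2 hl3 (by positivity)
    (hJ.trans ?_) ?_ ?_ rfl ?_ ?_ ?_ ?_
  · ring
  · -- Sv * Av
    have hN : w * ∑ a, sg a * D a (D a u) p
        = ((∑ a, sg a * D a (D a v) p) + (∑ b, sg b * (l * xi k b p) ^ 2) * v p) +
      (2 * (∑ b, sg b * (l * xi k b p) * D b v p) + l * psi k m p * v p)
      - (- (4 * m * GG k p) * l) * v p := by
      have e1 : ∀ a, sg a * D a (D a v) p = w * (sg a * D a (D a u) p)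
          - 2 * w * l * (sg a * xi k a p * D a u p) - w * u p * (sg a * (l * xid k a a p))
          + w * u p * (sg a * (l * xi k a p) ^ 2) := by
        intro a
        rw [hvdef, DD_vv k l hu]
        ring
      have e2 : ∀ a, sg a * (l * xi k a p) * D a v p = w * l * (sg a * xi k a p * D a u p)
         - w * u p * (sg a * (l * xi k a p) ^ 2) := by
        intro a
        rw [hvdef, D_vv k l hu]
        ring
      have e3 : v p = w * u p := rfl
      have e4 : l * psi k m p = ∑ a, sg a * (l * xid k a a p) + - (4 * m * GG k p) * l := by
        linarith [hWeq]
      rw [Finset.sum_congr rfl fun a _ => e1 a, Finset.sum_congr rfl fun a _ => e2 a, e3, e4]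
      simp only [Finset.sum_add_distrib, Finset.sum_sub_distrib, ← Finset.mul_sum]
      ring
    rw [hN]
    set S := (∑ a, sg a * D a (D a v) p) + (∑ b, sg b * (l * xi k b p) ^ 2) * v p
    set A := 2 * (∑ b, sg b * (l * xi k b p) * D b v p) + l * psi k m p * v p
    set W := (- (4 * m * GG k p) * l)
    nlinarith [sq_nonneg (S - A), sq_nonneg (S + A - 2 * W * v p), sq_nonneg (S + A)]
  · have h1 : (4 * m * GG k p) ^ 2 ≤ B ^ 2 := sq_le_sq' (by linarith [neg_le_of_abs_le hB3]) (le_of_abs_le hB3)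
    nlinarith [sq_nonneg l]
  · -- N
    have e3 : v p = w * u p := rfl
    have hw0 : 0 < w := Real.exp_pos _
    have hq : ∀ a, (w * D a u p) ^ 2 ≤ 2 * D a v p ^ 2 + 2 * (l ^ 2 * B ^ 2) * v p ^ 2 := by
      intro a
      have h1 : w * D a u p = D a v p + (l * xi k a p) * v p := by
        rw [hvdef, D_vv k l hu]; simp only [vv]; ring
      have h2 : (xi k a p) ^ 2 ≤ B ^ 2 :=
        sq_le_sq' (by linarith [neg_le_of_abs_le (hB1 a)]) (le_of_abs_le (hB1 a))
      rw [h1]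
      have h3 : (l * xi k a p * v p) ^ 2 ≤ l ^ 2 * B ^ 2 * v p ^ 2 := by
        rw [mul_pow, mul_pow]; gcongr
      nlinarith [sq_nonneg (D a v p - l * xi k a p * v p)]
    have hsum : ∑ a, (w * D a u p) ^ 2 ≤ 2 * S2
        + (Fintype.card (Option (Fin d)) : ℝ) * (2 * (l ^ 2 * B ^ 2) * v p ^ 2) := by
      refine (Finset.sum_le_sum fun a _ => hq a).trans (le_of_eq ?_)
      rw [Finset.sum_add_distrib, ← Finset.mul_sum, Finset.sum_const, Finset.card_univ, nsmul_eq_mul]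
    rw [Fintype.sum_option] at hsum
    set R := Real.sqrt (∑ j : Fin d, (D (some j) u p) ^ 2) with hR
    have hR2 : R ^ 2 = ∑ j : Fin d, (D (some j) u p) ^ 2 :=
      Real.sq_sqrt (Finset.sum_nonneg fun _ _ => sq_nonneg _)
    have hs2 : ∑ j : Fin d, (w * D (some j) u p) ^ 2 = (w * R) ^ 2 := by
      rw [mul_pow, hR2, Finset.mul_sum]; exact Finset.sum_congr rfl fun _ _ => by ring
    rw [hs2] at hsum
    have h4 : (∑ a, sg a * D a (D a u) p) ^ 2 ≤ (C * (|u p| + |D none u p| + R)) ^ 2 := by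
      rw [← sq_abs]; gcongr
    have h5 : (|u p| + |D none u p| + R) ^ 2 ≤ 3 * (u p ^ 2 + D none u p ^ 2 + R ^ 2) := by
      rw [← sq_abs (u p), ← sq_abs (D none u p)]
      nlinarith [sq_nonneg (|u p| - |D none u p|), sq_nonneg (|u p| - R), sq_nonneg (|D none u p| - R)]
    calc (w * ∑ a, sg a * D a (D a u) p) ^ 2 = w ^ 2 * (∑ a, sg a * D a (D a u) p) ^ 2 := by ring
      _ ≤ w ^ 2 * (C * (|u p| + |D none u p| + R)) ^ 2 := by gcongr
      _ = w ^ 2 * C ^ 2 * (|u p| + |D none u p| + R) ^ 2 := by ring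
      _ ≤ w ^ 2 * C ^ 2 * (3 * (u p ^ 2 + D none u p ^ 2 + R ^ 2)) := by gcongr
      _ = 3 * C ^ 2 * (v p ^ 2 + ((w * D none u p) ^ 2 + (w * R) ^ 2)) := by rw [e3]; ring
      _ ≤ 3 * C ^ 2 * (v p ^ 2 + (2 * S2
        + (Fintype.card (Option (Fin d)) : ℝ) * (2 * (l ^ 2 * B ^ 2) * v p ^ 2))) := by gcongr
      _ = _ := by ring
  · -- Zp
    have h1 : ∑ a, ss k a * D a v p ^ 2 = - k * D none v p ^ 2 + ∑ j, D (some j) v p ^ 2 := by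
      rw [Fintype.sum_option]; simp [ss]
    have h2 : ∑ a, sg a * D a v p ^ 2 = - D none v p ^ 2 + ∑ j, D (some j) v p ^ 2 := by
      rw [Fintype.sum_option]; simp [sg]
    have h3 : S2 = D none v p ^ 2 + ∑ j, D (some j) v p ^ 2 := by
      rw [hS2, Fintype.sum_option]
    rw [h1, h2, h3]
    have : 0 ≤ l * GG k p * (∑ a, sg a * (2 * ss k a * y a p) * D a v p) ^ 2 := by positivity
    generalize (∑ a, sg a * (2 * ss k a * y a p) * D a v p) = Y at this ⊢
    generalize (∑ j, D (some j) v p ^ 2) = Bx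
    generalize GG k p = Γ at this ⊢
    generalize D none v p = A
    rw [hk, hm]
    linarith
  · -- Zx
    have hxx : ∀ a, (l * xi k a p) ^ 2 = (l * GG k p) ^ 2 * (2 * ss k a * y a p) ^ 2 := by
      intro a; unfold xi; ring
    have h1 : ∑ a, ss k a * (l * xi k a p) ^ 2 = (l * GG k p) ^ 2 * (4 * (‖p.2‖ ^ 2 - k ^ 3 * p.1 ^ 2)) := by
      rw [Finset.sum_congr rfl fun a _ => by rw [hxx a], Fintype.sum_option, ← sum_sq]
      simp only [ss, y]
      rw [show (l * GG k p) ^ 2 * (4 * (∑ j, p.2 j ^ 2 - k ^ 3 * p.1 ^ 2)) =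
        ∑ j, (l * GG k p) ^ 2 * 4 * p.2 j ^ 2 - (l * GG k p) ^ 2 * 4 * k ^ 3 * p.1 ^ 2 by
          rw [← Finset.mul_sum]; ring]
      rw [Finset.sum_congr rfl fun j _ => show 1 * ((l * GG k p) ^ 2 * (2 * 1 * p.2 j) ^ 2)
        = (l * GG k p) ^ 2 * 4 * p.2 j ^ 2 by ring]
      ring
    have h2 : ∑ b, sg b * (l * xi k b p) ^ 2 = (l * GG k p) ^ 2 * (4 * (‖p.2‖ ^ 2 - k ^ 2 * p.1 ^ 2)) := by
      rw [Finset.sum_congr rfl fun a _ => by rw [hxx a], Fintype.sum_option, ← sum_sq]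
      simp only [ss, y, sg]
      rw [show (l * GG k p) ^ 2 * (4 * (∑ j, p.2 j ^ 2 - k ^ 2 * p.1 ^ 2)) =
        ∑ j, (l * GG k p) ^ 2 * 4 * p.2 j ^ 2 - (l * GG k p) ^ 2 * 4 * k ^ 2 * p.1 ^ 2 by
          rw [← Finset.mul_sum]; ring]
      rw [Finset.sum_congr rfl fun j _ => show 1 * ((l * GG k p) ^ 2 * (2 * 1 * p.2 j) ^ 2)
        = (l * GG k p) ^ 2 * 4 * p.2 j ^ 2 by ring]
      ring
    have h3 : ∑ a, sg a * (2 * ss k a * y a p) * (l * xi k a p)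
        = (l * GG k p) * (4 * (‖p.2‖ ^ 2 - k ^ 2 * p.1 ^ 2)) := by
      have hlG : l * GG k p ≠ 0 := by positivity
      apply mul_left_cancel₀ hlG
      rw [Finset.mul_sum]
      rw [← mul_assoc, ← sq, ← h2]
      refine Finset.sum_congr rfl fun a _ => ?_
      unfold xi; ring
    have hreg := region_alg p.1 ‖p.2‖ ε k m hε hε2 hk hm hr ht
    rw [h1, h2, h3]
    set q := ‖p.2‖ ^ 2 - k ^ 2 * p.1 ^ 2
    set q3 := ‖p.2‖ ^ 2 - k ^ 3 * p.1 ^ 2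
    have : 0 ≤ l ^ 3 * GG k p ^ 3 := by positivity
    calc _ = l ^ 3 * GG k p ^ 3 * (16 * q3 - 128 * q ^ 2 + 16 * m * q) := by ring
      _ ≤ l ^ 3 * GG k p ^ 3 * (-8) := by gcongr
      _ = _ := by ring
  · have := cross_bound (fun a => sg a) (fun a => D a v p) (fun a => l * D a (psi k m) p)
      (fun a => sg_sq a) (v p) l B (ε * g) hl0 (by positivity) (fun a => by
        rw [abs_mul, abs_of_nonneg hl0]; exact mul_le_mul_of_nonneg_left (hB2 a) hl0)
    rw [show 4 * (ε * g) = 4 * ε * g by ring] at this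
    exact this


/-! ### Part 4: the full gradient vanishes on the boundary cone -/

def Om (d : ℕ) : Set (E d) := {p : E d | 1 + |p.1| < ‖p.2‖}

theorem Om_open (d : ℕ) : IsOpen (Om d) :=
  isOpen_lt (by fun_prop) (by fun_prop)

theorem mem_closure_Om {d : ℕ} {p : E d} (h : 1 + |p.1| ≤ ‖p.2‖) : p ∈ closure (Om d) := by
  have hc : Continuous (fun η : ℝ => ((p.1, (1 + η) • p.2) : E d)) := by fun_prop
  have hmem : (0:ℝ) ∈ closure (Set.Ioi (0:ℝ)) := by simp
  have := map_mem_closure hc hmem (t := Om d) (fun η hη => ?_)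
  · simpa using this
  · have hη : 0 < η := hη
    change 1 + |p.1| < ‖(1 + η) • p.2‖
    rw [norm_smul, Real.norm_of_nonneg (by positivity)]
    have := abs_nonneg p.1
    nlinarith

theorem mem_frontier_Om {d : ℕ} {p : E d} (h : 1 + |p.1| = ‖p.2‖) : p ∈ frontier (Om d) := by
  rw [(Om_open d).frontier_eq]
  exact ⟨mem_closure_Om h.le, fun h' => absurd h (ne_of_lt h')⟩

theorem frontier_Om {d : ℕ} {p : E d} (h : p ∈ frontier (Om d)) : 1 + |p.1| = ‖p.2‖ :=
  frontier_lt_subset_eq (by fun_prop) (by fun_prop) h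

theorem fderiv_pair {d : ℕ} (g : E d → ℝ) (p : E d) (s : ℝ) (ω : EuclideanSpace ℝ (Fin d)) :
    fderiv ℝ g p (s, ω) = s * D none g p + ∑ j, ω j * D (some j) g p := by
  have h : ((s, ω) : E d) = s • e none + ∑ j, ω j • e (some j) := by
    refine Prod.ext ?_ ?_
    · simp [e, Prod.fst_sum]
    · simp only [e, Prod.snd_add, Prod.smul_snd, smul_zero, zero_add, Prod.snd_sum]
      ext i
      simp [Finset.sum_apply, Pi.single_apply]
  rw [h, map_add, map_smul, map_sum]
  simp [D]

noncomputable def cc {d : ℕ} (s : ℝ) (x : EuclideanSpace ℝ (Fin d)) : E d := (s * (‖x‖ - 1), x)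

theorem norm_line {d : ℕ} {x : EuclideanSpace ℝ (Fin d)} (hx : x ≠ 0) (j : Fin d) :
    HasDerivAt (fun τ : ℝ => ‖x + τ • EuclideanSpace.single j (1:ℝ)‖) (x j / ‖x‖) 0 := by
  have h1 : HasDerivAt (fun τ : ℝ => x + τ • EuclideanSpace.single j (1:ℝ))
      (EuclideanSpace.single j (1:ℝ)) 0 := by
    simpa using ((hasDerivAt_id (0:ℝ)).smul_const (EuclideanSpace.single j (1:ℝ))).const_add x
  have h2 := h1.norm_sq.sqrt (by simpa using hx)
  simp only [Real.sqrt_sq (norm_nonneg _)] at h2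
  refine h2.congr_deriv ?_
  simp only [zero_smul, add_zero, EuclideanSpace.inner_single_right]
  simp
  field_simp

theorem cone_line {d : ℕ} {g : E d → ℝ} (hg : Differentiable ℝ g) (s : ℝ)
    {x : EuclideanSpace ℝ (Fin d)} (hx : x ≠ 0) (j : Fin d) :
    HasDerivAt (fun τ : ℝ => g (cc s (x + τ • EuclideanSpace.single j (1:ℝ))))
      (s * (x j / ‖x‖) * D none g (cc s x) + D (some j) g (cc s x)) 0 := by
  have h1 : HasDerivAt (fun τ : ℝ => x + τ • EuclideanSpace.single j (1:ℝ))
      (EuclideanSpace.single j (1:ℝ)) 0 := by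
    simpa using ((hasDerivAt_id (0:ℝ)).smul_const (EuclideanSpace.single j (1:ℝ))).const_add x
  have h2 : HasDerivAt (fun τ : ℝ => cc s (x + τ • EuclideanSpace.single j (1:ℝ)))
      (s * (x j / ‖x‖), EuclideanSpace.single j (1:ℝ)) 0 :=
    (((norm_line hx j).sub_const 1).const_mul s).prodMk h1
  have h3 := (hg (cc s (x + (0:ℝ) • EuclideanSpace.single j (1:ℝ)))).hasFDerivAt.comp_hasDerivAt
    (0:ℝ) h2
  refine h3.congr_deriv ?_
  rw [fderiv_pair]
  simp

theorem ev_gt {d : ℕ} {x : EuclideanSpace ℝ (Fin d)} (hx : 1 < ‖x‖) (j : Fin d) :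
    ∀ᶠ τ : ℝ in nhds 0, 1 < ‖x + τ • EuclideanSpace.single j (1:ℝ)‖ := by
  have hc : Continuous (fun τ : ℝ => ‖x + τ • EuclideanSpace.single j (1:ℝ)‖) := by fun_prop
  have : (fun τ : ℝ => ‖x + τ • EuclideanSpace.single j (1:ℝ)‖) 0 = ‖x‖ := by simp
  exact hc.continuousAt.eventually (lt_mem_nhds (by rw [this]; exact hx))

theorem cone_zero {d : ℕ} {u : E d → ℝ} (hbd : ∀ p ∈ frontier (Om d), u p = 0)
    {s : ℝ} (hs : |s| = 1) {x : EuclideanSpace ℝ (Fin d)} (hx : 1 ≤ ‖x‖) : u (cc s x) = 0 := by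
  refine hbd _ (mem_frontier_Om ?_)
  simp only [cc, abs_mul, hs, one_mul]
  rw [abs_of_nonneg (by linarith)]; ring

theorem cone_first {d : ℕ} {u : E d → ℝ} (hu : ContDiff ℝ 2 u)
    (hbd : ∀ p ∈ frontier (Om d), u p = 0) {s : ℝ} (hs : |s| = 1) {x : EuclideanSpace ℝ (Fin d)} (hx : 1 < ‖x‖) (j : Fin d) :
    s * (x j / ‖x‖) * D none u (cc s x) + D (some j) u (cc s x) = 0 := by
  have hx0 : x ≠ 0 := by rintro rfl; simp at hx; linarith
  refine (cone_line (hu.differentiable (by norm_num)) s hx0 j).unique ?_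
  refine (hasDerivAt_const (0:ℝ) (0:ℝ)).congr_of_eventuallyEq ?_
  filter_upwards [ev_gt hx j] with τ hτ
  exact cone_zero hbd hs hτ.le

theorem cone_second {d : ℕ} {u : E d → ℝ} (hu : ContDiff ℝ 2 u)
    (hbd : ∀ p ∈ frontier (Om d), u p = 0) {s : ℝ} (hs : |s| = 1) {x : EuclideanSpace ℝ (Fin d)} (hx : 1 < ‖x‖) (j : Fin d) :
    s * (1 / ‖x‖ - x j ^ 2 / ‖x‖ ^ 3) * D none u (cc s x)
    + s * (x j / ‖x‖) * (s * (x j / ‖x‖) * D none (D none u) (cc s x)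
        + D (some j) (D none u) (cc s x))
    + (s * (x j / ‖x‖) * D none (D (some j) u) (cc s x) + D (some j) (D (some j) u) (cc s x)) = 0 := by
  have hx0 : x ≠ 0 := by rintro rfl; simp at hx; linarith
  have hn0 : ‖x‖ ≠ 0 := by simpa using hx0
  have hD := fun a => (D_smooth hu a).differentiable (by norm_num)
  have h1 : HasDerivAt (fun τ : ℝ => (x + τ • EuclideanSpace.single j (1:ℝ)) j) 1 0 := by
    simpa using (hasDerivAt_id (0:ℝ)).const_add (x j)
  have h2 := h1.div (norm_line hx0 j) (by simpa using hx0)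
  have h := ((h2.const_mul s).mul (cone_line (hD none) s hx0 j)).add (cone_line (hD (some j)) s hx0 j)
  have h0 := (hasDerivAt_const (0:ℝ) (0:ℝ)).congr_of_eventuallyEq (f₁ := fun τ : ℝ =>
    s * ((x + τ • EuclideanSpace.single j (1:ℝ)) j / ‖x + τ • EuclideanSpace.single j (1:ℝ)‖)
      * D none u (cc s (x + τ • EuclideanSpace.single j (1:ℝ)))
      + D (some j) u (cc s (x + τ • EuclideanSpace.single j (1:ℝ)))) (by
    filter_upwards [ev_gt hx j] with τ hτ
    exact cone_first hu hbd hs hτ j)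
  have := h.unique h0
  rw [← this]
  simp only [zero_smul, add_zero, Pi.div_apply]
  have : 1 / ‖x‖ - x j ^ 2 / ‖x‖ ^ 3 = (1 * ‖x‖ - x j * (x j / ‖x‖)) / ‖x‖ ^ 2 := by
    field_simp
  rw [this]

theorem cone_trace {d : ℕ} {u : E d → ℝ} (hu : ContDiff ℝ 2 u)
    (hbd : ∀ p ∈ frontier (Om d), u p = 0) {s : ℝ} (hs : |s| = 1) {x : EuclideanSpace ℝ (Fin d)} (hx : 1 < ‖x‖) :
    s * (((d : ℝ) - 1) / ‖x‖) * D none u (cc s x) + D none (D none u) (cc s x)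
      + 2 * s * (∑ j, (x j / ‖x‖) * D (some j) (D none u) (cc s x))
      + ∑ j, D (some j) (D (some j) u) (cc s x) = 0 := by
  have hx0 : x ≠ 0 := by rintro rfl; simp at hx; linarith
  have hn0 : ‖x‖ ≠ 0 := by simpa using hx0
  have hs2 : s ^ 2 = 1 := by rw [← sq_abs, hs]; norm_num
  have h := Finset.sum_eq_zero (s := Finset.univ) fun j (_ : j ∈ Finset.univ) =>
    cone_second hu hbd hs hx j
  have e : ∀ j, s * (1 / ‖x‖ - x j ^ 2 / ‖x‖ ^ 3) * D none u (cc s x)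
    + s * (x j / ‖x‖) * (s * (x j / ‖x‖) * D none (D none u) (cc s x)
        + D (some j) (D none u) (cc s x))
    + (s * (x j / ‖x‖) * D none (D (some j) u) (cc s x) + D (some j) (D (some j) u) (cc s x))
    = s / ‖x‖ * D none u (cc s x) - (s / ‖x‖ ^ 3 * D none u (cc s x)) * x j ^ 2
      + (D none (D none u) (cc s x) / ‖x‖ ^ 2) * x j ^ 2
      + (2 * s) * ((x j / ‖x‖) * D (some j) (D none u) (cc s x))
      + D (some j) (D (some j) u) (cc s x) := by
    intro j
    rw [DD_symm hu (some j) none]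
    have : s * (x j / ‖x‖) * (s * (x j / ‖x‖) * D none (D none u) (cc s x))
      = D none (D none u) (cc s x) / ‖x‖ ^ 2 * x j ^ 2 * s ^ 2 := by ring
    rw [mul_add (s * (x j / ‖x‖)), this, hs2]
    ring
  rw [Finset.sum_congr rfl fun j _ => e j] at h
  simp only [Finset.sum_add_distrib, Finset.sum_sub_distrib, ← Finset.mul_sum, sum_sq,
    Finset.sum_const, Finset.card_univ, Fintype.card_fin, nsmul_eq_mul] at h
  rw [← h]
  field_simp

theorem hineq_closure {d : ℕ} {u : E d → ℝ} (hu : ContDiff ℝ 2 u) {C : ℝ}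
    (hineq : ∀ p ∈ Om d, |∑ a, sg a * D a (D a u) p| ≤ C * (|u p| + |D none u p|
      + Real.sqrt (∑ j : Fin d, (D (some j) u p) ^ 2))) :
    ∀ p ∈ closure (Om d), |∑ a, sg a * D a (D a u) p| ≤ C * (|u p| + |D none u p|
      + Real.sqrt (∑ j : Fin d, (D (some j) u p) ^ 2)) := by
  have h0 := hu.continuous
  have h1 := fun a => (D_smooth hu a).continuous
  have h2 : ∀ a, Continuous (D a (D a u)) := fun a => by
    have := (D_smooth hu a).continuous_fderiv (by norm_num)
    unfold D at this ⊢
    exact this.clm_apply continuous_const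
  refine fun p hp => closure_minimal (t := {p | |∑ a, sg a * D a (D a u) p| ≤ C * (|u p| + |D none u p|
      + Real.sqrt (∑ j : Fin d, (D (some j) u p) ^ 2))}) hineq (isClosed_le ?_ ?_) hp
  · fun_prop
  · fun_prop

theorem grad_zero {d : ℕ} {u : E d → ℝ} (hu : ContDiff ℝ 2 u)
    (hbd : ∀ p ∈ frontier (Om d), u p = 0) {C : ℝ}
    (hineq : ∀ p ∈ Om d, |∑ a, sg a * D a (D a u) p| ≤ C * (|u p| + |D none u p|
      + Real.sqrt (∑ j : Fin d, (D (some j) u p) ^ 2))) :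
    ∀ p ∈ frontier (Om d), ∀ a, D a u p = 0 := by
  have hineq' := hineq_closure hu hineq
  have hD0 := fun a => (D_smooth hu a).continuous
  have hD := fun a => (D_smooth hu a).differentiable (by norm_num)
  -- reduce to time derivative along rays
  have key : ∀ s : ℝ, |s| = 1 → ∀ ω : EuclideanSpace ℝ (Fin d), ‖ω‖ = 1 →
      ∀ τ : ℝ, 1 ≤ τ → ∀ a, D a u (s * (τ - 1), τ • ω) = 0 := by
    -- first order relation for all τ ≥ 1
    have first : ∀ s : ℝ, |s| = 1 → ∀ ω : EuclideanSpace ℝ (Fin d), ‖ω‖ = 1 →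
        ∀ τ : ℝ, 1 ≤ τ → ∀ j, s * ω j * D none u (s * (τ - 1), τ • ω)
          + D (some j) u (s * (τ - 1), τ • ω) = 0 := by
      intro s hs ω hω τ hτ j
      have hcl : IsClosed {τ : ℝ | s * ω j * D none u (s * (τ - 1), τ • ω)
          + D (some j) u (s * (τ - 1), τ • ω) = 0} := by
        refine isClosed_eq ?_ continuous_const
        fun_prop
      have hsub : Set.Ioi (1:ℝ) ⊆ {τ : ℝ | s * ω j * D none u (s * (τ - 1), τ • ω)
          + D (some j) u (s * (τ - 1), τ • ω) = 0} := by
        intro τ hτ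
        have hτ : 1 < τ := hτ
        have hn : ‖τ • ω‖ = τ := by rw [norm_smul, hω, Real.norm_of_nonneg (by linarith), mul_one]
        have := cone_first hu hbd hs (x := τ • ω) (by rw [hn]; exact hτ) j
        simp only [cc, hn] at this
        have e : (τ • ω) j / τ = ω j := by
          simp; field_simp
        rw [e] at this
        exact this
      have := closure_minimal hsub hcl
      rw [closure_Ioi] at this
      exact this hτ
    intro s hs ω hω
    have hs2 : s ^ 2 = 1 := by rw [← sq_abs, hs]; norm_num
    have hω2 : ∑ j, ω j ^ 2 = 1 := by rw [sum_sq, hω]; norm_num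
    set h : ℝ → ℝ := fun τ => D none u (s * (τ - 1), τ • ω) with hh
    set h' : ℝ → ℝ := fun τ => s * D none (D none u) (s * (τ - 1), τ • ω)
      + ∑ j, ω j * D (some j) (D none u) (s * (τ - 1), τ • ω) with hh'
    have hder : ∀ τ, HasDerivAt h (h' τ) τ := by
      intro τ
      have h1 : HasDerivAt (fun τ : ℝ => ((s * (τ - 1), τ • ω) : E d)) (s, ω) τ := by
        refine HasDerivAt.prodMk ?_ ?_
        · simpa using ((hasDerivAt_id τ).sub_const 1).const_mul s
        · simpa using (hasDerivAt_id τ).smul_const ω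
      have h2 := (hD none (s * (τ - 1), τ • ω)).hasFDerivAt.comp_hasDerivAt τ h1
      rw [fderiv_pair] at h2
      exact h2
    have hcont' : Continuous h' := by
      have h2 : ∀ a, Continuous (D a (D none u)) := fun a => by
        have := (D_smooth hu none).continuous_fderiv (by norm_num)
        unfold D at this ⊢
        exact this.clm_apply continuous_const
      fun_prop
    have hcont : Continuous h := by fun_prop
    have hb : ∀ τ, 1 ≤ τ → ‖h' τ‖ ≤ (C + d) * ‖h τ‖ := by
      have hcl : IsClosed {τ : ℝ | ‖h' τ‖ ≤ (C + d) * ‖h τ‖} :=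
        isClosed_le (by fun_prop) (by fun_prop)
      have hsub : Set.Ioi (1:ℝ) ⊆ {τ : ℝ | ‖h' τ‖ ≤ (C + d) * ‖h τ‖} := by
        intro τ hτ
        have hτ : 1 < τ := hτ
        have hn : ‖τ • ω‖ = τ := by rw [norm_smul, hω, Real.norm_of_nonneg (by linarith), mul_one]
        have ht := cone_trace hu hbd hs (x := τ • ω) (by rw [hn]; exact hτ)
        have hz := cone_zero hbd hs (x := τ • ω) (by rw [hn]; exact hτ.le)
        simp only [cc, hn] at ht hz
        have e : ∀ j, (τ • ω) j / τ = ω j := fun j => by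
          simp; field_simp
        simp only [e] at ht
        have hq := hineq' (s * (τ - 1), τ • ω) (mem_closure_Om (by
          simp only [abs_mul, hs, hn, one_mul]
          rw [abs_of_nonneg (by linarith)]; linarith))
        have hj : ∑ j, D (some j) u (s * (τ - 1), τ • ω) ^ 2 = h τ ^ 2 := by
          have : ∀ j, D (some j) u (s * (τ - 1), τ • ω) ^ 2 = h τ ^ 2 * ω j ^ 2 := by
            intro j
            have := first s hs ω hω τ hτ.le j
            have : D (some j) u (s * (τ - 1), τ • ω) = - (s * ω j * h τ) := by
              simp only [hh]; linarith
            rw [this]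
            linear_combination (ω j ^ 2 * h τ ^ 2) * hs2
          rw [Finset.sum_congr rfl fun j _ => this j, ← Finset.mul_sum, hω2, mul_one]
        rw [hz, hj, Real.sqrt_sq_eq_abs, abs_zero, Fintype.sum_option] at hq
        simp only [sg] at hq
        change |-1 * D none (D none u) (s * (τ - 1), τ • ω)
          + ∑ j, 1 * D (some j) (D (some j) u) (s * (τ - 1), τ • ω)| ≤ C * (0 + |h τ| + |h τ|) at hq
        simp only [one_mul] at hq
        change |h' τ| ≤ (C + d) * |h τ|
        change s * (((d:ℝ) - 1) / τ) * h τ + _ + _ + _ = 0 at ht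
        set Δ := ∑ j, D (some j) (D (some j) u) (s * (τ - 1), τ • ω)
        set U := D none (D none u) (s * (τ - 1), τ • ω) with hU
        set M := ∑ j, ω j * D (some j) (D none u) (s * (τ - 1), τ • ω) with hM
        have hh'τ : h' τ = s * U + M := rfl
        have h2 : 2 * s * h' τ = - (-1 * U + Δ) - s * (((d:ℝ) - 1) / τ) * h τ := by
          rw [hh'τ]; linear_combination ht + (2 * U) * hs2
        have h3 : |2 * s * h' τ| = 2 * |h' τ| := by
          rw [abs_mul, abs_mul, hs]; norm_num
        have h4 : |s * (((d:ℝ) - 1) / τ) * h τ| ≤ (d + 1) * |h τ| := by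
          rw [abs_mul, abs_mul, hs, one_mul]
          gcongr
          rw [abs_div, abs_of_pos (show 0 < τ by linarith), div_le_iff₀ (by linarith)]
          have : |(d:ℝ) - 1| ≤ d + 1 := by
            rw [abs_le]; constructor <;> linarith [Nat.cast_nonneg (α := ℝ) d]
          nlinarith [Nat.cast_nonneg (α := ℝ) d]
        have h5 : 2 * |h' τ| ≤ |(-1 * U + Δ)| + |s * (((d:ℝ) - 1) / τ) * h τ| := by
          rw [← h3, h2]
          refine (abs_sub _ _).trans ?_
          rw [abs_neg]
        have hd1 : (1:ℝ) ≤ d := by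
          rcases Nat.eq_zero_or_pos d with h0 | h0
          · subst h0
            simp at hω2
          · exact_mod_cast h0
        nlinarith [abs_nonneg (h τ)]
      have := closure_minimal hsub hcl
      rw [closure_Ioi] at this
      exact fun τ hτ => this hτ
    have h1 : h 1 = 0 := by
      have hex : ∃ j, ω j ≠ 0 := by
        by_contra hcon
        push Not at hcon
        simp [hcon] at hω2
      obtain ⟨j, hj⟩ := hex
      have a1 := first 1 (by norm_num) ω hω 1 le_rfl j
      have a2 := first (-1) (by norm_num) ω hω 1 le_rfl j
      simp only [sub_self, mul_zero, one_mul] at a1 a2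
      have : ω j * D none u (0, (1:ℝ) • ω) = 0 := by linarith
      simp only [hh, sub_self, mul_zero]
      exact (mul_eq_zero.mp this).resolve_left hj
    intro τ hτ
    have hz : h τ = 0 := eq_zero_of_abs_deriv_le_mul_abs_self_of_eq_zero_right (f := h) (f' := h')
      (K := C + d) (a := 1) (b := τ) hcont.continuousOn
      (fun x _ => (hder x).hasDerivWithinAt) h1 (fun x hx => hb x hx.1) τ ⟨hτ, le_rfl⟩
    intro a
    cases a with
    | none => exact hz
    | some j =>
      have := first s hs ω hω τ hτ j
      change s * ω j * h τ + _ = 0 at this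
      rw [hz] at this
      linarith
  intro p hp a
  have hp' := frontier_Om hp
  have hr : 1 ≤ ‖p.2‖ := by linarith [abs_nonneg p.1]
  have hr0 : ‖p.2‖ ≠ 0 := by linarith
  obtain ⟨s, hs, hs'⟩ : ∃ s : ℝ, |s| = 1 ∧ s * (‖p.2‖ - 1) = p.1 := by
    rcases le_total 0 p.1 with h | h
    · refine ⟨1, by norm_num, ?_⟩
      rw [← hp', abs_of_nonneg h]; ring
    · refine ⟨-1, by norm_num, ?_⟩
      rw [← hp', abs_of_nonpos h]; ring
  have := key s hs (‖p.2‖⁻¹ • p.2) (by rw [norm_smul, norm_inv, norm_norm, inv_mul_cancel₀ hr0]) ‖p.2‖ hr a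
  rw [hs', smul_smul, mul_inv_cancel₀ hr0, one_smul] at this
  exact this


/-! ### Part 5: integration and conclusion -/

theorem indicator_hasFDerivAt {d : ℕ} {H : E d → ℝ} (hH : Differentiable ℝ H)
    (h0 : ∀ p ∈ frontier (Om d), H p = 0) (h1 : ∀ p ∈ frontier (Om d), fderiv ℝ H p = 0) (p : E d) :
    HasFDerivAt ((Om d).indicator H) ((Om d).indicator (fderiv ℝ H) p) p := by
  by_cases hp : p ∈ Om d
  · rw [Set.indicator_of_mem hp]
    refine (hH p).hasFDerivAt.congr_of_eventuallyEq ?_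
    filter_upwards [(Om_open d).mem_nhds hp] with q hq
    exact Set.indicator_of_mem hq _
  · rw [Set.indicator_of_notMem hp]
    by_cases hc : p ∈ closure (Om d)
    · have hf : p ∈ frontier (Om d) := by
        rw [(Om_open d).frontier_eq]; exact ⟨hc, hp⟩
      have hd := (hH p).hasFDerivAt
      rw [h1 p hf] at hd
      rw [hasFDerivAt_iff_isLittleO] at hd ⊢
      refine Asymptotics.IsBigO.trans_isLittleO ?_ hd
      refine Asymptotics.IsBigO.of_bound 1 (Filter.Eventually.of_forall fun q => ?_)
      rw [Set.indicator_of_notMem hp, h0 p hf]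
      simp only [sub_zero, one_mul, zero_apply]
      exact norm_indicator_le_norm_self _ _
    · refine (hasFDerivAt_const (0:ℝ) p).congr_of_eventuallyEq ?_
      filter_upwards [isClosed_closure.isOpen_compl.mem_nhds hc] with q hq
      exact Set.indicator_of_notMem (fun h => hq (subset_closure h)) _

theorem D_cont {d : ℕ} {H : E d → ℝ} (hH : ContDiff ℝ 1 H) (a : Option (Fin d)) :
    Continuous (D a H) := by
  have := hH.continuous_fderiv (by norm_num)
  unfold D
  exact this.clm_apply continuous_const

theorem D_supp {d : ℕ} {H : E d → ℝ} (hs : HasCompactSupport H) (a : Option (Fin d)) :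
    HasCompactSupport (D a H) := hs.fderiv_apply ℝ (e a)

theorem haar_E (d : ℕ) : (volume : Measure (E d)).IsAddHaarMeasure := by
  rw [Measure.volume_eq_prod]
  infer_instance

theorem integral_D_zero {d : ℕ} {H : E d → ℝ} (hH : ContDiff ℝ 1 H) (hs : HasCompactSupport H)
    (h0 : ∀ p ∈ frontier (Om d), H p = 0) (h1 : ∀ p ∈ frontier (Om d), fderiv ℝ H p = 0)
    (a : Option (Fin d)) : ∫ p in Om d, D a H p = 0 := by
  have hd := indicator_hasFDerivAt (hH.differentiable (by norm_num)) h0 h1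
  have hm : MeasurableSet (Om d) := (Om_open d).measurableSet
  have := haar_E d
  have e1 : ∀ p, fderiv ℝ ((Om d).indicator H) p (e a) = (Om d).indicator (D a H) p := by
    intro p
    rw [(hd p).fderiv]
    by_cases hp : p ∈ Om d <;> simp [hp, D]
  have hi : Integrable H := hH.continuous.integrable_of_hasCompactSupport hs
  have hi' : Integrable (D a H) := (D_cont hH a).integrable_of_hasCompactSupport (D_supp hs a)
  have := integral_mul_fderiv_eq_neg_fderiv_mul_of_integrable (μ := (volume : Measure (E d)))
    (f := fun _ : E d => (1:ℝ)) (g := (Om d).indicator H) (v := e a)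
    (by simp) (by simp only [one_mul, e1]; exact hi'.indicator hm)
    (by simp only [one_mul]; exact hi.indicator hm)
    (fun _ _ => differentiableAt_const _) (fun p _ => (hd p).differentiableAt)
  simp only [one_mul, e1, fderiv_fun_const, Pi.zero_apply, zero_apply, zero_mul,
    integral_zero, neg_zero] at this
  rwa [integral_indicator hm] at this

theorem D_mul {d : ℕ} {f g : E d → ℝ} (hf : Differentiable ℝ f) (hg : Differentiable ℝ g)
    (a : Option (Fin d)) (p : E d) :
    D a (fun q => f q * g q) p = D a f p * g p + f p * D a g p := by
  refine D_eq ((hf p).mul (hg p)) a ?_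
  have h := (line_deriv (hf p) a).mul (line_deriv (hg p) a)
  refine h.congr_deriv ?_
  simp

theorem fderiv_zero_of_D {d : ℕ} {g : E d → ℝ} {p : E d} (h : ∀ a, D a g p = 0) :
    fderiv ℝ g p = 0 := by
  refine ContinuousLinearMap.ext fun q => ?_
  obtain ⟨s, ω⟩ := q
  rw [fderiv_pair]
  simp [h]

theorem JJ_bound {d : ℕ} (k m l B w : ℝ) (v : E d → ℝ) (p : E d) (a : Option (Fin d))
    (hl : 1 ≤ l) (hB : 0 ≤ B) (hw : 0 ≤ w) (hv : |v p| ≤ w * B) (hD : ∀ b, |D b v p| ≤ w * (l * B))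
    (hx : ∀ b, |xi k b p| ≤ B) (hψ : |psi k m p| ≤ B) :
    |JJ k m l v a p| ≤ (3 * (Fintype.card (Option (Fin d)) : ℝ) * B ^ 3 + B ^ 3
      + (Fintype.card (Option (Fin d)) : ℝ) * B ^ 5) * (l ^ 3 * w ^ 2) := by
  have hl0 : 0 ≤ l := by linarith
  have hsg : ∀ b : Option (Fin d), |sg b| = 1 := fun b => by cases b <;> simp [sg]
  have hx' : ∀ b, |l * xi k b p| ≤ l * B := fun b => by
    rw [abs_mul, abs_of_nonneg hl0]; exact mul_le_mul_of_nonneg_left (hx b) hl0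
  have hψ' : |l * psi k m p| ≤ l * B := by
    rw [abs_mul, abs_of_nonneg hl0]; exact mul_le_mul_of_nonneg_left hψ hl0
  have hsum : ∀ (F : Option (Fin d) → ℝ) (c : ℝ), (∀ b, |F b| ≤ c) →
      |∑ b, F b| ≤ (Fintype.card (Option (Fin d)) : ℝ) * c := by
    intro F c h
    refine (Finset.abs_sum_le_sum_abs _ _).trans ((Finset.sum_le_sum fun b _ => h b).trans ?_)
    rw [Finset.sum_const, Finset.card_univ, nsmul_eq_mul]
  set n := (Fintype.card (Option (Fin d)) : ℝ) with hn
  have hn0 : 0 ≤ n := by positivity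
  have s1 : |∑ b, sg b * (l * xi k b p) * D b v p| ≤ n * (l * B * (w * (l * B))) := by
    refine hsum _ _ fun b => ?_
    rw [abs_mul, abs_mul, hsg, one_mul]
    gcongr
    · exact hx' b
    · exact hD b
  have s2 : |∑ b, sg b * D b v p ^ 2| ≤ n * (w * (l * B)) ^ 2 := by
    refine hsum _ _ fun b => ?_
    rw [abs_mul, hsg, one_mul, abs_pow]
    gcongr
    exact hD b
  have s3 : |∑ b, sg b * (l * xi k b p) ^ 2| ≤ n * (l * B) ^ 2 := by
    refine hsum _ _ fun b => ?_
    rw [abs_mul, hsg, one_mul, abs_pow]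
    gcongr
    exact hx' b
  unfold JJ
  rw [abs_mul, hsg, one_mul]
  have t1 : |2 * D a v p * (∑ b, sg b * (l * xi k b p) * D b v p)|
      ≤ 2 * (w * (l * B)) * (n * (l * B * (w * (l * B)))) := by
    rw [abs_mul, abs_mul, abs_two]
    gcongr
    exact hD a
  have t2 : |(l * xi k a p) * (∑ b, sg b * D b v p ^ 2)| ≤ l * B * (n * (w * (l * B)) ^ 2) := by
    rw [abs_mul]
    gcongr
    exact hx' a
  have t3 : |(l * psi k m p) * v p * D a v p| ≤ l * B * (w * B) * (w * (l * B)) := by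
    rw [abs_mul, abs_mul]
    gcongr
    exact hD a
  have t4 : |(∑ b, sg b * (l * xi k b p) ^ 2) * (l * xi k a p) * v p ^ 2|
      ≤ n * (l * B) ^ 2 * (l * B) * (w * B) ^ 2 := by
    rw [abs_mul, abs_mul, abs_pow]
    gcongr
    exact hx' a
  have t5 : l * B * (w * B) * (w * (l * B)) ≤ B ^ 3 * (l ^ 3 * w ^ 2) := by
    have : l ^ 2 ≤ l ^ 3 := by nlinarith [sq_nonneg l]
    calc l * B * (w * B) * (w * (l * B)) = B ^ 3 * (l ^ 2 * w ^ 2) := by ring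
      _ ≤ _ := by gcongr
  refine (abs_add_le _ _).trans ?_
  refine (add_le_add (abs_add_le _ _) le_rfl).trans ?_
  refine (add_le_add (add_le_add (abs_sub _ _) le_rfl) le_rfl).trans ?_
  calc _ ≤ 2 * (w * (l * B)) * (n * (l * B * (w * (l * B)))) + l * B * (n * (w * (l * B)) ^ 2)
      + B ^ 3 * (l ^ 3 * w ^ 2) + n * (l * B) ^ 2 * (l * B) * (w * B) ^ 2 := by
        gcongr
        exact t3.trans t5
    _ = _ := by ring

theorem ff_eq {d : ℕ} (k : ℝ) (p : E d) : ff k p = ‖p.2‖ ^ 2 - k * p.1 ^ 2 := by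
  unfold ff
  rw [Fintype.sum_option, ← sum_sq]
  simp [ss, y]
  ring

theorem exists_cutoff {d : ℕ} {K U : Set (E d)} (hK : IsCompact K) (hU : IsOpen U) (hKU : K ⊆ U) :
    ∃ ζ : E d → ℝ, ContDiff ℝ 1 ζ ∧ (∀ p ∈ K, ∀ᶠ q in nhds p, ζ q = 1) ∧ (∀ p ∉ U, ζ p = 0)
      ∧ ∀ p, 0 ≤ ζ p := by
  obtain ⟨f, h1, h2, h3⟩ := exists_contMDiffMap_one_nhds_of_subset_interior
    (modelWithCornersSelf ℝ (E d)) (n := 1) hK.isClosed (hU.interior_eq.symm ▸ hKU)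
  refine ⟨f, ?_, ?_, h2, fun p => (h3 p).1⟩
  · have := f.contMDiff.contDiff
    simpa using this
  · intro p hp
    exact h1.filter_mono (nhds_le_nhdsSet hp)


theorem exists_bound {d : ℕ} {Q : Set (E d)} (hQ : IsCompact Q) {F : E d → ℝ} (hF : Continuous F) :
    ∃ B, 0 ≤ B ∧ ∀ p ∈ Q, |F p| ≤ B := by
  obtain ⟨B, hB⟩ := hQ.exists_bound_of_continuousOn hF.continuousOn
  exact ⟨max B 0, le_max_right _ _, fun p hp => (hB p hp).trans (le_max_left _ _)⟩

set_option maxHeartbeats 1000000 in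
theorem main {d : ℕ} {u : E d → ℝ} (hu : ContDiff ℝ 2 u)
    (hbd : ∀ p ∈ frontier (Om d), u p = 0) {C : ℝ}
    (hineq : ∀ p ∈ Om d, |∑ a, sg a * D a (D a u) p| ≤ C * (|u p| + |D none u p|
      + Real.sqrt (∑ j : Fin d, (D (some j) u p) ^ 2))) :
    ∀ p ∈ Om d, u p = 0 := by
  have hgrad := grad_zero hu hbd hineq
  intro p0 hp0
  have := haar_E d
  -- parameters
  obtain ⟨c0, hc0⟩ : ∃ c0, c0 = ‖p0.2‖ ^ 2 + 1 := ⟨_, rfl⟩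
  obtain ⟨c1, hc1⟩ : ∃ c1, c1 = c0 + 1 := ⟨_, rfl⟩
  obtain ⟨T, hT⟩ : ∃ T, T = c1 + |p0.1| + 1 := ⟨_, rfl⟩
  have hc0p : 1 ≤ c0 := by rw [hc0]; nlinarith [sq_nonneg ‖p0.2‖]
  have hT1 : 1 ≤ T := by have := abs_nonneg p0.1; linarith
  obtain ⟨ε, hε⟩ : ∃ ε, ε = 1 / (2 * T) := ⟨_, rfl⟩
  have hε0 : 0 < ε := by rw [hε]; positivity
  have hεT : 2 * ε * T = 1 := by rw [hε]; field_simp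
  have hε2 : ε ≤ 1 / 2 := by nlinarith
  obtain ⟨k, hk⟩ : ∃ k, k = 1 + ε := ⟨_, rfl⟩
  obtain ⟨m, hm⟩ : ∃ m, m = 1 + ε / 2 := ⟨_, rfl⟩
  have hffc : Continuous (ff k : E d → ℝ) := (ff_smooth k).continuous
  -- the compact set
  set K : Set (E d) := {p | 1 + |p.1| ≤ ‖p.2‖ ∧ |p.1| ≤ T ∧ ff k p ≤ c1} with hK
  obtain ⟨R, hR⟩ : ∃ R, R = T + c1 + k * T ^ 2 + 2 := ⟨_, rfl⟩
  have hk0 : 0 < k := by linarith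
  have hKR : K ⊆ Metric.ball (0 : E d) R := by
    rintro p ⟨h1, h2, h3⟩
    rw [mem_ball_zero_iff, Prod.norm_def]
    have h4 : p.1 ^ 2 ≤ T ^ 2 := by rw [← sq_abs]; gcongr
    have h5 : k * p.1 ^ 2 ≤ k * T ^ 2 := by gcongr
    rw [ff_eq] at h3
    have h6 : 0 ≤ k * T ^ 2 := by positivity
    refine max_lt ?_ ?_
    · rw [Real.norm_eq_abs]; linarith
    · nlinarith [norm_nonneg p.2]
  have hKc : IsCompact K := by
    refine (isCompact_closedBall (0 : E d) R).of_isClosed_subset ?_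
      (hKR.trans Metric.ball_subset_closedBall)
    have k1 : IsClosed {p : E d | 1 + |p.1| ≤ ‖p.2‖} := isClosed_le (by fun_prop) (by fun_prop)
    have k2 : IsClosed {p : E d | |p.1| ≤ T} := isClosed_le (by fun_prop) continuous_const
    exact k1.inter (k2.inter (isClosed_le hffc continuous_const))
  set U : Set (E d) := Metric.ball 0 R ∩ {p | |p.1| < T} with hU
  have hUo : IsOpen U := Metric.isOpen_ball.inter (isOpen_lt (by fun_prop) continuous_const)
  have hKU : K ⊆ U := by
    intro p hp
    refine ⟨hKR hp, ?_⟩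
    obtain ⟨h1, h2, h3⟩ := hp
    refine lt_of_le_of_ne h2 fun h => ?_
    rw [ff_eq, ← sq_abs p.1, h] at h3
    rw [h] at h1
    have : (1 + T) ^ 2 ≤ ‖p.2‖ ^ 2 := by gcongr
    have := abs_nonneg p0.1
    have : k * T ^ 2 = T ^ 2 + T / 2 := by rw [hk]; nlinarith
    nlinarith
  obtain ⟨ζ, hζ, hζ1, hζ0, hζn⟩ := exists_cutoff hKc hUo hKU
  set Q := Metric.closedBall (0 : E d) R with hQ
  have hQc : IsCompact Q := isCompact_closedBall _ _
  have hζs : HasCompactSupport ζ := HasCompactSupport.intro hQc fun p hp =>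
    hζ0 p fun h => hp (Metric.ball_subset_closedBall h.1)
  have hDζQ : ∀ p ∉ Q, ∀ a, D a ζ p = 0 := by
    intro p hp a
    have : ζ =ᶠ[nhds p] fun _ => 0 := by
      filter_upwards [Metric.isClosed_closedBall.isOpen_compl.mem_nhds hp] with q hq
      exact hζ0 q fun h => hq (Metric.ball_subset_closedBall h.1)
    unfold D; rw [this.fderiv_eq]; simp
  have hDζ : ∀ p ∈ Om d, ff k p ≤ c1 → ∀ a, D a ζ p = 0 := by
    intro p hp hf a
    by_cases hpT : |p.1| ≤ T
    · have : ζ =ᶠ[nhds p] fun _ => 1 := hζ1 p ⟨le_of_lt hp, hpT, hf⟩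
      unfold D; rw [this.fderiv_eq]; simp
    · have : ζ =ᶠ[nhds p] fun _ => 0 := by
        have ho : IsOpen {q : E d | T < |q.1|} := isOpen_lt continuous_const (by fun_prop)
        filter_upwards [ho.mem_nhds (not_le.mp hpT)] with q hq
        exact hζ0 q fun h => absurd h.2 (not_lt.mpr (le_of_lt hq))
      unfold D; rw [this.fderiv_eq]; simp
  -- bounds
  have hDu := fun a => (D_smooth hu a).continuous
  have hxic := fun a : Option (Fin d) => (xi_smooth k a).continuous
  have hpsic := (psi_smooth (d := d) k m).continuous
  have hDpsic := fun a : Option (Fin d) => (D_smooth (psi_smooth (d := d) k m) a).continuous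
  have hGc := (GG_smooth (d := d) k).continuous
  have hDζc := fun a => D_cont hζ a
  have huc := hu.continuous
  obtain ⟨B, hB0, hB⟩ : ∃ B : ℝ, 0 ≤ B ∧ ∀ p ∈ Q, |u p| ≤ B ∧ |psi k m p| ≤ B
      ∧ |4 * m * GG k p| ≤ B ∧ ∀ a, |xi k a p| ≤ B ∧ |D a (psi k m) p| ≤ B ∧
        |D a u p| + |xi k a p| * |u p| ≤ B ∧ |D a ζ p| ≤ B := by
    obtain ⟨B1, hB10, hB1⟩ := exists_bound hQc (F := fun p => |u p| + |psi k m p|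
      + |4 * m * GG k p|) (by fun_prop)
    have : ∀ a, ∃ B, 0 ≤ B ∧ ∀ p ∈ Q, |(|xi k a p| + |D a (psi k m) p| +
        (|D a u p| + |xi k a p| * |u p|) + |D a ζ p|)| ≤ B := fun a => exists_bound hQc (by fun_prop)
    choose B2 hB20 hB2 using this
    refine ⟨B1 + ∑ a, B2 a, add_nonneg hB10 (Finset.sum_nonneg fun a _ => hB20 a), fun p hp => ?_⟩
    have h1 := (le_abs_self _).trans (hB1 p hp)
    have hS : 0 ≤ ∑ a, B2 a := Finset.sum_nonneg fun a _ => hB20 a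
    have n1 := abs_nonneg (u p)
    have n2 := abs_nonneg (psi k m p)
    have n3 := abs_nonneg (4 * m * GG k p)
    refine ⟨by linarith, by linarith, by linarith, fun a => ?_⟩
    have h2 := (le_abs_self _).trans (hB2 a p hp)
    have h3 : B2 a ≤ ∑ a, B2 a := Finset.single_le_sum (fun a _ => hB20 a) (Finset.mem_univ a)
    have n4 := abs_nonneg (xi k a p)
    have n5 := abs_nonneg (D a (psi k m) p)
    have n6 := abs_nonneg (D a u p)
    have n7 := abs_nonneg (D a ζ p)
    have n8 := mul_nonneg n4 n1
    refine ⟨by linarith, by linarith, by linarith, by linarith⟩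
  obtain ⟨g, hg, hgG⟩ : ∃ g : ℝ, 0 < g ∧ ∀ p ∈ Q, g ≤ GG k p := by
    have hne : Q.Nonempty := ⟨p0, by
      have hp0' : 1 + |p0.1| < ‖p0.2‖ := hp0
      rw [hQ, mem_closedBall_zero_iff, Prod.norm_def]
      have h6 : 0 ≤ k * T ^ 2 := by positivity
      have := abs_nonneg p0.1
      refine max_le ?_ ?_
      · rw [Real.norm_eq_abs]; linarith
      · nlinarith [norm_nonneg p0.2]⟩
    obtain ⟨q, hq, hmin⟩ := hQc.exists_isMinOn hne hGc.continuousOn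
    exact ⟨GG k q, GG_pos k q, fun p hp => hmin hp⟩
  set n := (Fintype.card (Option (Fin d)) : ℝ) with hn
  have hn0 : 0 ≤ n := by positivity
  set MJ := 3 * n * B ^ 3 + B ^ 3 + n * B ^ 5 with hMJ
  -- the set where we conclude
  set A : Set (E d) := Om d ∩ ({p | |p.1| < T} ∩ {p | ff k p < c0}) with hA
  have hAo : IsOpen A := (Om_open d).inter ((isOpen_lt (by fun_prop) continuous_const).inter
    (isOpen_lt hffc continuous_const))
  have hAK : A ⊆ K := by
    rintro p ⟨h1, h2, h3⟩
    have h3 : ff k p < c0 := h3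
    exact ⟨le_of_lt h1, le_of_lt h2, by linarith⟩
  have hp0A : p0 ∈ A := by
    refine ⟨hp0, ?_, ?_⟩
    · change |p0.1| < T; linarith
    · change ff k p0 < c0
      rw [ff_eq, hc0]
      have : 0 ≤ k * p0.1 ^ 2 := by positivity
      linarith
  have hAQ : A ⊆ Q := hAK.trans (hKR.trans Metric.ball_subset_closedBall)
  have hu2A : IntegrableOn (fun p => u p ^ 2) A :=
    ((huc.pow 2).continuousOn.integrableOn_compact hQc).mono_set hAQ
  set I := ∫ p in A, u p ^ 2 with hI
  have hI0 : 0 ≤ I := integral_nonneg fun p => sq_nonneg _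
  set V := (volume : Measure (E d)).real Q with hV
  -- Carleman inequality
  have carl : ∀ l : ℝ, 1 ≤ l → 6 * C ^ 2 ≤ l * (ε * g) →
      1 + 3 * C ^ 2 + 6 * C ^ 2 * n * B ^ 2 + B ^ 2 + n * B ^ 2 / (4 * ε * g) ≤ 8 * l * g ^ 3 →
      Real.exp (l * Real.exp (-4 * c0)) ^ 2 * I
        ≤ V * (n * (B * (MJ * (l ^ 3 * Real.exp (l * Real.exp (-4 * c1)) ^ 2)))) := by
    intro l hl1 hl2 hl3
    have hl0 : 0 ≤ l := by linarith
    set v := vv k l u with hv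
    have hvs : ContDiff ℝ 2 v := vv_smooth k l hu
    set w1 := Real.exp (l * Real.exp (-4 * c1)) with hw1
    set w0 := Real.exp (l * Real.exp (-4 * c0)) with hw0
    set H : Option (Fin d) → E d → ℝ := fun a p => ζ p * JJ k m l v a p with hH
    have hJs := fun a => JJ_smooth k m l hvs a
    have hHs : ∀ a, ContDiff ℝ 1 (H a) := fun a => hζ.mul (hJs a)
    have hHc : ∀ a, HasCompactSupport (H a) := fun a => hζs.mul_right
    have hDH : ∀ a p, D a (H a) p = D a ζ p * JJ k m l v a p + ζ p * D a (JJ k m l v a) p :=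
      fun a p => D_mul (hζ.differentiable (by norm_num)) ((hJs a).differentiable (by norm_num)) a p
    have hv0 : ∀ p ∈ frontier (Om d), v p = 0 := fun p hp => by
      simp [hv, vv, hbd p hp]
    have hDv0 : ∀ p ∈ frontier (Om d), ∀ b, D b v p = 0 := fun p hp b => by
      rw [hv, D_vv k l hu, hbd p hp, hgrad p hp b]; simp
    have hJ0 : ∀ p ∈ frontier (Om d), ∀ a, JJ k m l v a p = 0 := fun p hp a => by
      simp [JJ, hv0 p hp, hDv0 p hp]
    have hDJ0 : ∀ p ∈ frontier (Om d), ∀ a c, D c (JJ k m l v a) p = 0 := fun p hp a c => by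
      rw [JJ_D k m l hvs a p c]
      simp [hv0 p hp, hDv0 p hp]
    have hint0 : ∀ a, ∫ p in Om d, D a (H a) p = 0 := by
      intro a
      refine integral_D_zero (hHs a) (hHc a) (fun p hp => ?_) (fun p hp => ?_) a
      · simp [hH, hJ0 p hp]
      · refine fderiv_zero_of_D fun c => ?_
        have := D_mul (hζ.differentiable (by norm_num)) ((hJs a).differentiable (by norm_num)) c p
        simp only [hH]
        rw [this, hJ0 p hp, hDJ0 p hp]
        simp
    have hHi : ∀ a, Integrable (D a (H a)) := fun a =>
      (D_cont (hHs a) a).integrable_of_hasCompactSupport (D_supp (hHc a) a)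
    have hEi : ∀ a, Integrable (fun p => D a ζ p * JJ k m l v a p) := fun a =>
      ((hDζc a).mul (hJs a).continuous).integrable_of_hasCompactSupport (D_supp hζs a).mul_right
    have hvi : Integrable (fun p => ζ p * v p ^ 2) :=
      (hζ.continuous.mul (hvs.continuous.pow 2)).integrable_of_hasCompactSupport hζs.mul_right
    -- pointwise
    have hpt : ∀ p ∈ Om d, ζ p * v p ^ 2 ≤ ∑ a, D a ζ p * JJ k m l v a p - ∑ a, D a (H a) p := by
      intro p hp
      have e1 : ∑ a, D a ζ p * JJ k m l v a p - ∑ a, D a (H a) p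
          = - (ζ p * ∑ a, D a (JJ k m l v a) p) := by
        rw [Finset.sum_congr rfl fun a _ => hDH a p, Finset.sum_add_distrib, Finset.mul_sum]
        ring
      rw [e1]
      by_cases hpU : p ∈ U
      · have hpQ : p ∈ Q := Metric.ball_subset_closedBall hpU.1
        have hpT : |p.1| < T := hpU.2
        obtain ⟨b1, b2, b3, b4⟩ := hB p hpQ
        have := pointwise hu C ε k m g B l p hε0 hε2 hk hm (le_of_lt hp)
          (by nlinarith) (hineq p hp) hg (hgG p hpQ)
          (fun a => (b4 a).1) (fun a => (b4 a).2.1) b3 hl1 hl2 hl3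
        have h2 := mul_le_mul_of_nonneg_left this (hζn p)
        rw [mul_zero, mul_add] at h2
        linarith
      · rw [hζ0 p hpU]; simp
    have hOm : MeasurableSet (Om d) := (Om_open d).measurableSet
    have step1 : ∫ p in Om d, ζ p * v p ^ 2 ≤ ∫ p in Om d, ∑ a, D a ζ p * JJ k m l v a p := by
      have i1 : Integrable (fun p => ∑ a, D a ζ p * JJ k m l v a p) :=
        integrable_finsetSum _ fun a _ => hEi a
      have i2 : Integrable (fun p => ∑ a, D a (H a) p) := integrable_finsetSum _ fun a _ => hHi a
      have := setIntegral_mono_on hvi.integrableOn (i1.sub i2).integrableOn hOm hpt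
      refine this.trans (le_of_eq ?_)
      have e3 := integral_sub (μ := volume.restrict (Om d)) i1.integrableOn i2.integrableOn
      refine e3.trans ?_
      rw [integral_finsetSum _ fun a _ => (hHi a).integrableOn]
      simp [hint0]
    -- error bound
    set cst := n * (B * (MJ * (l ^ 3 * w1 ^ 2))) with hcst
    have hMJ0 : 0 ≤ MJ := by positivity
    have hcst0 : 0 ≤ cst := by positivity
    have herr : ∀ p ∈ Om d, ∑ a, D a ζ p * JJ k m l v a p ≤ Q.indicator (fun _ => cst) p := by
      intro p hp
      by_cases hpQ : p ∈ Q
      · rw [Set.indicator_of_mem hpQ]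
        by_cases hf : ff k p ≤ c1
        · simp only [hDζ p hp hf, zero_mul, Finset.sum_const_zero]
          exact hcst0
        · have hf : c1 ≤ ff k p := le_of_not_ge hf
          obtain ⟨b1, b2, b3, b4⟩ := hB p hpQ
          have hwle : Real.exp (l * Real.exp (-4 * ff k p)) ≤ w1 := by
            rw [hw1]
            gcongr Real.exp (l * Real.exp ?_)
            linarith
          have hw1p : 0 ≤ w1 := (Real.exp_pos _).le
          have hb : ∀ a, |JJ k m l v a p| ≤ MJ * (l ^ 3 * w1 ^ 2) := by
            intro a
            refine JJ_bound k m l B w1 v p a hl1 hB0 hw1p ?_ (fun b => ?_)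
              (fun b => (b4 b).1) b2
            · simp only [hv, vv]
              rw [abs_mul, abs_of_pos (Real.exp_pos _)]
              gcongr
            · rw [hv, D_vv k l hu, abs_mul, abs_of_pos (Real.exp_pos _)]
              gcongr
              refine (abs_sub _ _).trans ?_
              have h3 := (b4 b).2.2.1
              rw [abs_mul, abs_mul, abs_of_nonneg hl0]
              have h4 := abs_nonneg (D b u p)
              nlinarith
          calc ∑ a, D a ζ p * JJ k m l v a p ≤ ∑ _a : Option (Fin d), B * (MJ * (l ^ 3 * w1 ^ 2)) := by
                refine Finset.sum_le_sum fun a _ => (le_abs_self _).trans ?_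
                rw [abs_mul]
                gcongr
                · exact (b4 a).2.2.2
                · exact hb a
            _ = cst := by
                rw [Finset.sum_const, Finset.card_univ, nsmul_eq_mul]
      · rw [Set.indicator_of_notMem hpQ]
        simp [hDζQ p hpQ]
    have hQm : MeasurableSet Q := hQc.measurableSet
    have hQfin : (volume : Measure (E d)) Q ≠ ⊤ := hQc.measure_lt_top.ne
    have hci : Integrable (Q.indicator (fun _ : E d => cst)) := by
      rw [integrable_indicator_iff hQm]
      exact integrableOn_const hQfin
    have step2 : ∫ p in Om d, ∑ a, D a ζ p * JJ k m l v a p ≤ V * cst := by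
      have i1 : Integrable (fun p => ∑ a, D a ζ p * JJ k m l v a p) :=
        integrable_finsetSum _ fun a _ => hEi a
      refine (setIntegral_mono_on i1.integrableOn hci.integrableOn hOm herr).trans ?_
      refine (setIntegral_le_integral hci (Filter.Eventually.of_forall fun p =>
        Set.indicator_nonneg (fun _ _ => hcst0) p)).trans ?_
      rw [integral_indicator hQm, setIntegral_const, smul_eq_mul]
    have step0 : w0 ^ 2 * I ≤ ∫ p in Om d, ζ p * v p ^ 2 := by
      have h1 : w0 ^ 2 * I = ∫ p in A, w0 ^ 2 * u p ^ 2 := by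
        rw [hI, integral_const_mul]
      rw [h1]
      have h2 : ∫ p in A, w0 ^ 2 * u p ^ 2 ≤ ∫ p in A, ζ p * v p ^ 2 := by
        refine setIntegral_mono_on (hu2A.const_mul _) hvi.integrableOn hAo.measurableSet ?_
        intro p hp
        rw [(hζ1 p (hAK hp)).self_of_nhds, one_mul]
        simp only [hv, vv, mul_pow]
        have hf : ff k p < c0 := hp.2.2
        gcongr
        rw [hw0]
        gcongr Real.exp (l * Real.exp ?_)
        linarith
      refine h2.trans ?_
      refine setIntegral_mono_set hvi.integrableOn ?_ (Filter.Eventually.of_forall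
        (fun p hp => hp.1))
      exact Filter.Eventually.of_forall fun p => mul_nonneg (hζn p) (sq_nonneg _)
    exact step0.trans (step1.trans step2)
  -- limit
  set δ := Real.exp (-4 * c0) - Real.exp (-4 * c1) with hδ
  have hδ0 : 0 < δ := by
    rw [hδ, sub_pos]
    apply Real.exp_lt_exp.mpr; linarith
  have hbound : ∀ᶠ l : ℝ in Filter.atTop, I ≤ V * (n * (B * MJ)) / (2 * δ) ^ 3 *
      ((2 * δ * l) ^ 3 * Real.exp (- (2 * δ * l))) := by
    filter_upwards [Filter.eventually_ge_atTop (1:ℝ), Filter.eventually_ge_atTop (6 * C ^ 2 / (ε * g)),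
      Filter.eventually_ge_atTop ((1 + 3 * C ^ 2 + 6 * C ^ 2 * n * B ^ 2 + B ^ 2
        + n * B ^ 2 / (4 * ε * g)) / (8 * g ^ 3))] with l h1 h2 h3
    have h2' : 6 * C ^ 2 ≤ l * (ε * g) := by
      rwa [div_le_iff₀ (by positivity)] at h2
    rw [div_le_iff₀ (by positivity)] at h3
    have := carl l h1 h2' (by linarith)
    have e1 : Real.exp (- (2 * δ * l)) * Real.exp (l * Real.exp (-4 * c0)) ^ 2
        = Real.exp (l * Real.exp (-4 * c1)) ^ 2 := by
      rw [← Real.exp_nat_mul, ← Real.exp_nat_mul, ← Real.exp_add]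
      congr 1
      rw [hδ]; push_cast; ring
    have hw : 0 < Real.exp (l * Real.exp (-4 * c0)) ^ 2 := by positivity
    refine le_of_mul_le_mul_left (this.trans (le_of_eq ?_)) hw
    rw [← e1]
    field_simp
  have hlim : Filter.Tendsto (fun l : ℝ => V * (n * (B * MJ)) / (2 * δ) ^ 3 *
      ((2 * δ * l) ^ 3 * Real.exp (- (2 * δ * l)))) Filter.atTop (nhds 0) := by
    have h1 := (Real.tendsto_pow_mul_exp_neg_atTop_nhds_zero 3).comp
      (Filter.tendsto_id.const_mul_atTop (show 0 < 2 * δ by positivity))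
    have h2 := h1.const_mul (V * (n * (B * MJ)) / (2 * δ) ^ 3)
    rw [mul_zero] at h2
    exact h2
  have hIz : I = 0 := le_antisymm (ge_of_tendsto hlim hbound) hI0
  have hae := (setIntegral_eq_zero_iff_of_nonneg_ae
    (Filter.Eventually.of_forall fun p => sq_nonneg (u p)) hu2A).mp hIz
  have heq := Measure.eqOn_open_of_ae_eq hae hAo (huc.pow 2).continuousOn continuousOn_const
  have := heq hp0A
  simpa using this

end UCW

/-- **Ionescu–Klainerman model theorem** (Theorem 1.1 of the paper).
Let `Ω = {(t,x) : |x| > 1 + |t|}`.  If `u` is `C²` on `ℝ^{1+d}`, vanishes on the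
topological boundary `∂Ω`, and satisfies the differential inequality
`|□u| ≤ C(|u| + |∂_t u| + |∇_x u|)` on `Ω`, then `u` vanishes identically on `Ω`. -/
theorem unique_continuation_wave_model
    (d : ℕ) (hd : 1 ≤ d)
    (Ω : Set (ℝ × EuclideanSpace ℝ (Fin d)))
    (hΩ : Ω = {p : ℝ × EuclideanSpace ℝ (Fin d) | 1 + |p.1| < ‖p.2‖})
    (u : ℝ × EuclideanSpace ℝ (Fin d) → ℝ)
    (hu : ContDiff ℝ 2 u)
    (hbd : ∀ p ∈ frontier Ω, u p = 0)
    (C : ℝ) (hC : 0 ≤ C)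
    (hineq : ∀ p ∈ Ω,
      |iteratedFDeriv ℝ 2 u p ![((1 : ℝ), (0 : EuclideanSpace ℝ (Fin d))), (1, 0)]
        - ∑ j : Fin d, iteratedFDeriv ℝ 2 u p
            ![((0 : ℝ), EuclideanSpace.single j (1 : ℝ)), (0, EuclideanSpace.single j 1)]|
      ≤ C * (|u p| + |fderiv ℝ u p ((1 : ℝ), (0 : EuclideanSpace ℝ (Fin d)))|
          + Real.sqrt (∑ j : Fin d,
              (fderiv ℝ u p ((0 : ℝ), EuclideanSpace.single j (1 : ℝ))) ^ 2))) :
    ∀ p ∈ Ω, u p = 0 := by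
  subst hΩ
  refine UCW.main (d := d) hu hbd (C := C) (fun p hp => ?_)
  have hd2 : DifferentiableAt ℝ (fderiv ℝ u) p :=
    (hu.fderiv_right (m := 1) (by norm_num)).differentiable (by norm_num) p
  have h1 : ∀ a : Option (Fin d), UCW.D a (UCW.D a u) p
      = iteratedFDeriv ℝ 2 u p ![UCW.e a, UCW.e a] := by
    intro a
    rw [iteratedFDeriv_two_apply]
    unfold UCW.D
    rw [fderiv_clm_apply hd2 (by fun_prop)]
    simp
  have h2 := hineq p hp
  have h3 : ∑ a, UCW.sg a * UCW.D a (UCW.D a u) p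
      = -(iteratedFDeriv ℝ 2 u p ![((1 : ℝ), (0 : EuclideanSpace ℝ (Fin d))), (1, 0)]
        - ∑ j : Fin d, iteratedFDeriv ℝ 2 u p
            ![((0 : ℝ), EuclideanSpace.single j (1 : ℝ)), (0, EuclideanSpace.single j 1)]) := by
    rw [Fintype.sum_option]
    simp only [h1, UCW.sg, UCW.e]
    rw [neg_sub, neg_one_mul]
    simp only [one_mul]
    ring
  rw [h3, abs_neg]
  exact h2
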